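/- Let r, s ∈ (0,∞) and let X be an ℝ^d-valued random variable with distribution P whose absolutely continuous part P_a = f·λ_d is nonzero, and suppose E|X|^{r+η} < ∞ for some η > 0. Let (α_n)_{n≥1} be an asymptotically L^r(P)-optimal sequence of quantizers. Then for every θ > 0 and every μ ∈ ℝ^d, liminf_{n→∞} n^{s/d} ∫_{ℝ^d} d(x, α_n^{θ,μ})^s dP(x) ≥ θ^{s+d} · J_{s,d} · (∫_{ℝ^d} f^{d/(d+r)} dλ_d)^{s/d} · ∫_{{f>0}} f_{θ,μ} · f^{−s/(d+r)} dλ_d. -/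

import Mathlib

open MeasureTheory ENNReal Filter Set Metric Topology
open scoped Classical

noncomputable section

/-- Distance from a point `x` to a finite codebook `α`. -/
def qdist {d : ℕ} (x : EuclideanSpace ℝ (Fin d)) (α : Finset (EuclideanSpace ℝ (Fin d))) : ℝ :=
  Metric.infDist x (α : Set (EuclideanSpace ℝ (Fin d)))

/-- The `r`-th power `L^r` quantization error `∫ d(x,α)^r dP` of a codebook `α`. -/
def qerr {d : ℕ} (P : Measure (EuclideanSpace ℝ (Fin d))) (r : ℝ)
    (α : Finset (EuclideanSpace ℝ (Fin d))) : ℝ≥0∞ :=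
  ∫⁻ x, ENNReal.ofReal (qdist x α) ^ r ∂P

/-- The optimal `n`-level `L^r` quantization error `e_{n,r}(P)`. -/
def enr {d : ℕ} (P : Measure (EuclideanSpace ℝ (Fin d))) (r : ℝ) (n : ℕ) : ℝ≥0∞ :=
  ⨅ (α : Finset (EuclideanSpace ℝ (Fin d))) (_ : α.Nonempty) (_ : α.card ≤ n),
    qerr P r α ^ (1 / r)

/-- The uniform distribution on the unit cube `[0,1]^d`. -/
def unifCube (d : ℕ) : Measure (EuclideanSpace ℝ (Fin d)) :=
  volume.restrict {x | ∀ i, x i ∈ Icc (0 : ℝ) 1}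

/-- The constant `J_{r,d} = inf_{n ≥ 1} n^{r/d} e_{n,r}(U([0,1]^d))^r`. -/
def Jrd (r : ℝ) (d : ℕ) : ℝ≥0∞ :=
  ⨅ (n : ℕ) (_ : 1 ≤ n), (n : ℝ≥0∞) ^ (r / (d : ℝ)) * enr (unifCube d) r n ^ r

/-- Zador's constant `Q_r(P)` for a measure whose a.c. part has density `f`. -/
def Qr {d : ℕ} (f : EuclideanSpace ℝ (Fin d) → ℝ) (r : ℝ) : ℝ≥0∞ :=
  Jrd r d * (∫⁻ x, ENNReal.ofReal (f x) ^ ((d : ℝ) / ((d : ℝ) + r))) ^ (((d : ℝ) + r) / (d : ℝ))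

/-- The dilated/contracted codebook `α^{θ,μ} = μ + θ(α - μ)`. -/
def dilate {d : ℕ} (α : Finset (EuclideanSpace ℝ (Fin d))) (θ : ℝ)
    (μ : EuclideanSpace ℝ (Fin d)) : Finset (EuclideanSpace ℝ (Fin d)) :=
  α.image fun a => μ + θ • (a - μ)

/-- `f_{θ,μ}(x) = f(μ + θ(x-μ))`. -/
def fdil {d : ℕ} (f : EuclideanSpace ℝ (Fin d) → ℝ) (θ : ℝ)
    (μ x : EuclideanSpace ℝ (Fin d)) : ℝ :=
  f (μ + θ • (x - μ))

/-- The image measure `P_{θ,μ}` of `P` under `x ↦ (x-μ)/θ + μ`. -/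
def Pdil {d : ℕ} (P : Measure (EuclideanSpace ℝ (Fin d))) (θ : ℝ)
    (μ : EuclideanSpace ℝ (Fin d)) : Measure (EuclideanSpace ℝ (Fin d)) :=
  Measure.map (fun x => μ + θ⁻¹ • (x - μ)) P

/-- `(θ,μ)` is `P`-admissible for `P = f·λ_d`:
`{f>0} ⊆ μ(1-θ) + θ{f>0}` up to a `λ_d`-null set.  (Note that
`x ∈ μ(1-θ) + θ{f>0}` iff `f((x-μ)/θ + μ) > 0`.) -/
def Admissible {d : ℕ} (f : EuclideanSpace ℝ (Fin d) → ℝ) (θ : ℝ)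
    (μ : EuclideanSpace ℝ (Fin d)) : Prop :=
  ∀ᵐ x ∂(volume : Measure (EuclideanSpace ℝ (Fin d))),
    0 < f x → 0 < f (μ + θ⁻¹ • (x - μ))

/-- The maximal function `ψ_b` attached to `P` and the sequence of codebooks `α`. -/
def maxFun {d : ℕ} (P : Measure (EuclideanSpace ℝ (Fin d)))
    (α : ℕ → Finset (EuclideanSpace ℝ (Fin d))) (b : ℝ)
    (x : EuclideanSpace ℝ (Fin d)) : ℝ≥0∞ :=
  ⨆ (n : ℕ) (_ : 1 ≤ n),
    volume (Metric.ball x (b * qdist x (α n))) / P (Metric.ball x (b * qdist x (α n)))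

/-- An `L^r(P)`-optimal sequence of `n`-quantizers. -/
def OptimalSeq {d : ℕ} (P : Measure (EuclideanSpace ℝ (Fin d))) (r : ℝ)
    (α : ℕ → Finset (EuclideanSpace ℝ (Fin d))) : Prop :=
  ∀ n, 1 ≤ n → (α n).Nonempty ∧ (α n).card ≤ n ∧ qerr P r (α n) = enr P r n ^ r

/-- An asymptotically `L^r(P)`-optimal sequence of quantizers,
for `P` whose a.c. part has density `f`. -/
def AsympOptimalSeq {d : ℕ} (P : Measure (EuclideanSpace ℝ (Fin d)))
    (f : EuclideanSpace ℝ (Fin d) → ℝ) (r : ℝ)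
    (α : ℕ → Finset (EuclideanSpace ℝ (Fin d))) : Prop :=
  (∀ n, 1 ≤ n → (α n).Nonempty ∧ (α n).card ≤ n) ∧
  Tendsto (fun n : ℕ => (n : ℝ≥0∞) ^ (r / (d : ℝ)) * qerr P r (α n)) atTop (𝓝 (Qr f r))

/-- `L^s(P)`-rate-optimality of a sequence of codebooks. -/
def RateOptimal {d : ℕ} (P : Measure (EuclideanSpace ℝ (Fin d))) (s : ℝ)
    (β : ℕ → Finset (EuclideanSpace ℝ (Fin d))) : Prop :=
  limsup (fun n : ℕ => (n : ℝ≥0∞) ^ (s / (d : ℝ)) * qerr P s (β n)) atTop < ⊤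

/-- The support of a measure. -/
def msupp {d : ℕ} (P : Measure (EuclideanSpace ℝ (Fin d))) : Set (EuclideanSpace ℝ (Fin d)) :=
  {x | ∀ ε > 0, 0 < P (Metric.ball x ε)}

/-- Hypothesis (H1): for every `M > 0`,
`sup { f(μ+θ(z-μ))/f(z) : z ∈ B(0,M), f(z) > 0 } < ∞`. -/
def H1 {d : ℕ} (f : EuclideanSpace ℝ (Fin d) → ℝ) (θ : ℝ)
    (μ : EuclideanSpace ℝ (Fin d)) : Prop :=
  ∀ M > (0 : ℝ), ∃ C : ℝ, ∀ z ∈ Metric.ball (0 : EuclideanSpace ℝ (Fin d)) M,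
    0 < f z → f (μ + θ • (z - μ)) / f z ≤ C

/-- Hypothesis (H2). -/
def H2 {d : ℕ} (P : Measure (EuclideanSpace ℝ (Fin d))) (θ : ℝ)
    (μ : EuclideanSpace ℝ (Fin d)) (s r : ℝ) : Prop :=
  ∃ b ∈ Ioo (0 : ℝ) (1 / 2), ∃ M > (0 : ℝ),
    (∫⁻ x in {x : EuclideanSpace ℝ (Fin d) | M < ‖x‖},
      (⨆ t ∈ Ioc (0 : ℝ) (2 * b * ‖x‖),
        volume (Metric.ball x t) / P (Metric.ball x t)) ^ (s / ((d : ℝ) + r))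
      ∂(Pdil P θ μ)) < ⊤

/-- Hypothesis (H3): `λ_d(· ∩ supp P) ≪ P` and `supp P` is a finite union of
closed convex sets. -/
def H3 {d : ℕ} (P : Measure (EuclideanSpace ℝ (Fin d))) : Prop :=
  volume.restrict (msupp P) ≪ P ∧
  ∃ (k : ℕ) (C : Fin k → Set (EuclideanSpace ℝ (Fin d))),
    (∀ i, IsClosed (C i) ∧ Convex ℝ (C i)) ∧ msupp P = ⋃ i, C i

theorem volume_setOf_forall_mem {d : ℕ} (S : Fin d → Set ℝ) :
    volume {x : EuclideanSpace ℝ (Fin d) | ∀ i, x i ∈ S i} = ∏ i, volume (S i) := by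
  rw [← volume_pi_pi, ← (PiLp.volume_preserving_toLp (Fin d)).measure_preimage_emb
    (MeasurableEquiv.toLp 2 (Fin d → ℝ)).measurableEmbedding]
  congr 1
  ext x
  simp [Set.mem_pi]

theorem lintegral_affine {d : ℕ} (b : EuclideanSpace ℝ (Fin d)) {ℓ : ℝ} (hℓ : 0 < ℓ)
    (F : EuclideanSpace ℝ (Fin d) → ℝ≥0∞) (hF : Measurable F) :
    ∫⁻ x, F x = ENNReal.ofReal ℓ ^ d * ∫⁻ y, F (b + ℓ • y) := by
  have h1 : ∫⁻ x, F x = ∫⁻ x, F (b + x) := (lintegral_add_left_eq_self F b).symm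
  have h2 : ∫⁻ y, F (b + ℓ • y) =
      ∫⁻ x, F (b + x) ∂(Measure.map (fun y : EuclideanSpace ℝ (Fin d) => ℓ • y) volume) := by
    rw [lintegral_map (by fun_prop) (by fun_prop)]
  rw [h1, h2, Measure.map_addHaar_smul _ hℓ.ne', lintegral_smul_measure, finrank_euclideanSpace,
    Fintype.card_fin, abs_of_pos (by positivity), smul_eq_mul, ← mul_assoc,
    ← ENNReal.ofReal_pow hℓ.le, ← ENNReal.ofReal_mul (by positivity),
    mul_inv_cancel₀ (by positivity), ENNReal.ofReal_one, one_mul]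

open scoped Pointwise in
theorem qdist_affine {d : ℕ} (b : EuclideanSpace ℝ (Fin d)) {ℓ : ℝ} (hℓ : 0 < ℓ)
    (y : EuclideanSpace ℝ (Fin d)) (γ : Finset (EuclideanSpace ℝ (Fin d))) :
    qdist (b + ℓ • y) (γ.image fun a => b + ℓ • a) = ℓ * qdist y γ := by
  have h : ((γ.image fun a => b + ℓ • a : Finset _) : Set (EuclideanSpace ℝ (Fin d))) =
      (fun x => b + x) '' (ℓ • (γ : Set (EuclideanSpace ℝ (Fin d)))) := by
    rw [Finset.coe_image, ← Set.image_smul, Set.image_image]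
  unfold qdist
  rw [h, Metric.infDist_image (isometry_add_left b), infDist_smul₀ hℓ.ne', Real.norm_of_nonneg hℓ.le]

theorem measurable_qdist {d : ℕ} (γ : Finset (EuclideanSpace ℝ (Fin d))) :
    Measurable fun x => qdist x γ := by
  unfold qdist; exact measurable_infDist

/-- The half-open box with lower corner `a` and side length `ℓ`. -/
def box {d : ℕ} (a : EuclideanSpace ℝ (Fin d)) (ℓ : ℝ) : Set (EuclideanSpace ℝ (Fin d)) :=
  {x | ∀ i, x i ∈ Ico (a i) (a i + ℓ)}

theorem measurableSet_setOf_forall_mem {d : ℕ} (S : Fin d → Set ℝ) (hS : ∀ i, MeasurableSet (S i)) :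
    MeasurableSet {x : EuclideanSpace ℝ (Fin d) | ∀ i, x i ∈ S i} := by
  rw [ofPred_forall]
  exact MeasurableSet.iInter fun i => (hS i).preimage (by fun_prop)

theorem measurableSet_box {d : ℕ} (a : EuclideanSpace ℝ (Fin d)) (ℓ : ℝ) :
    MeasurableSet (box a ℓ) :=
  measurableSet_setOf_forall_mem _ fun _ => measurableSet_Ico

theorem volume_box {d : ℕ} (a : EuclideanSpace ℝ (Fin d)) (ℓ : ℝ) :
    volume (box a ℓ) = ENNReal.ofReal ℓ ^ d := by
  unfold box
  rw [volume_setOf_forall_mem]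
  simp

theorem unifCube_eq (d : ℕ) :
    unifCube d = volume.restrict (box (0 : EuclideanSpace ℝ (Fin d)) 1) := by
  unfold unifCube
  symm
  apply Measure.restrict_congr_set
  apply ae_eq_of_subset_of_measure_ge
  · intro x hx i
    have := hx i
    simp only [PiLp.zero_apply, zero_add, mem_Ico, mem_Icc] at *
    exact ⟨this.1, this.2.le⟩
  · rw [volume_box, volume_setOf_forall_mem]
    simp
  · exact (measurableSet_box _ _).nullMeasurableSet
  · rw [volume_setOf_forall_mem]
    simp

theorem mem_box_affine {d : ℕ} (a y : EuclideanSpace ℝ (Fin d)) {ℓ : ℝ} (hℓ : 0 < ℓ) :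
    a + ℓ • y ∈ box a ℓ ↔ y ∈ box (0 : EuclideanSpace ℝ (Fin d)) 1 := by
  unfold box
  simp only [mem_ofPred_eq, mem_Ico, PiLp.add_apply, PiLp.smul_apply, smul_eq_mul, PiLp.zero_apply,
    zero_add]
  refine forall_congr' fun i => ?_
  constructor
  · rintro ⟨h1, h2⟩
    constructor <;> nlinarith
  · rintro ⟨h1, h2⟩
    constructor <;> nlinarith

theorem Jrd_le_unifCube {d : ℕ} {s : ℝ} (hs : 0 < s) (γ : Finset (EuclideanSpace ℝ (Fin d)))
    (hγ : γ.Nonempty) {N : ℕ} (hN : γ.card ≤ N) :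
    Jrd s d ≤ (N : ℝ≥0∞) ^ (s / d) * qerr (unifCube d) s γ := by
  have hN1 : 1 ≤ N := hγ.card_pos.trans_le hN
  unfold Jrd
  refine (iInf₂_le N hN1).trans ?_
  gcongr
  have : enr (unifCube d) s N ≤ qerr (unifCube d) s γ ^ (1 / s) := by
    unfold enr
    exact (iInf_le _ γ).trans ((iInf_le _ hγ).trans (iInf_le _ hN))
  calc enr (unifCube d) s N ^ s ≤ (qerr (unifCube d) s γ ^ (1 / s)) ^ s := by gcongr
    _ = _ := by rw [← ENNReal.rpow_mul]; simp [hs.ne']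

theorem Jrd_mul_le_lintegral_box {d : ℕ} {s : ℝ} (hs : 0 < s) (a : EuclideanSpace ℝ (Fin d))
    {ℓ : ℝ} (hℓ : 0 < ℓ) (γ : Finset (EuclideanSpace ℝ (Fin d)))
    (hγ : γ.Nonempty) {N : ℕ} (hN : γ.card ≤ N) :
    Jrd s d * (ENNReal.ofReal ℓ ^ d * ENNReal.ofReal ℓ ^ s) ≤
      (N : ℝ≥0∞) ^ (s / d) * ∫⁻ x in box a ℓ, ENNReal.ofReal (qdist x γ) ^ s := by
  set γ' := γ.image fun x => ℓ⁻¹ • (x - a) with hγ'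
  have himg : γ = γ'.image fun y => a + ℓ • y := by
    rw [hγ', Finset.image_image]
    conv_lhs => rw [← Finset.image_id (s := γ)]
    apply Finset.image_congr
    intro x _
    simp [smul_smul, hℓ.ne']
  have key : ∫⁻ x in box a ℓ, ENNReal.ofReal (qdist x γ) ^ s =
      ENNReal.ofReal ℓ ^ d * ENNReal.ofReal ℓ ^ s * qerr (unifCube d) s γ' := by
    rw [← lintegral_indicator (measurableSet_box a ℓ), lintegral_affine a hℓ]
    · rw [mul_assoc]
      congr 1
      unfold qerr
      rw [unifCube_eq, ← lintegral_indicator (measurableSet_box _ _),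
        ← lintegral_const_mul' _ _ (by finiteness)]
      congr 1
      ext y
      by_cases hy : y ∈ box (0 : EuclideanSpace ℝ (Fin d)) 1
      · rw [indicator_of_mem ((mem_box_affine a y hℓ).2 hy), indicator_of_mem hy]
        conv_lhs => rw [himg]
        rw [qdist_affine a hℓ, ENNReal.ofReal_mul hℓ.le, ENNReal.mul_rpow_of_nonneg _ _ hs.le]
      · rw [indicator_of_notMem (mt (mem_box_affine a y hℓ).1 hy), indicator_of_notMem hy, mul_zero]
    · exact (((measurable_qdist γ).ennreal_ofReal).pow_const s).indicator (measurableSet_box a ℓ)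
  rw [key, mul_comm (Jrd s d), mul_left_comm ((N : ℝ≥0∞) ^ (s / (d : ℝ)))]
  exact mul_le_mul' le_rfl
    (Jrd_le_unifCube hs γ' (hγ.image _) (Finset.card_image_le.trans hN))

theorem exists_grid {d : ℕ} (a : EuclideanSpace ℝ (Fin d)) {ℓ : ℝ} (hℓ : 0 < ℓ) {m : ℕ}
    (hm : 1 ≤ m) : ∃ G : Finset (EuclideanSpace ℝ (Fin d)), G.Nonempty ∧ G.card ≤ m ^ d ∧
      ∀ x ∈ box a ℓ, qdist x G ≤ √d * (ℓ / m) := by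
  have hm0 : (0 : ℝ) < m := by exact_mod_cast hm
  let pt : (Fin d → Fin m) → EuclideanSpace ℝ (Fin d) := fun j =>
    WithLp.toLp 2 fun i => a i + (j i : ℝ) * (ℓ / m)
  refine ⟨Finset.univ.image pt, ?_, ?_, ?_⟩
  · have : Nonempty (Fin m) := ⟨⟨0, hm⟩⟩
    exact Finset.univ_nonempty.image _
  · refine Finset.card_image_le.trans ?_
    simp
  · intro x hx
    have hfl : ∀ i, ∃ j : Fin m, |x i - (a i + (j : ℝ) * (ℓ / m))| ≤ ℓ / m := by
      intro i
      obtain ⟨h1, h2⟩ := hx i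
      have h3 : 0 ≤ (x i - a i) / (ℓ / m) := by
        have : 0 ≤ x i - a i := by linarith
        positivity
      have h4 : (x i - a i) / (ℓ / m) < m := by
        rw [div_lt_iff₀ (by positivity)]
        have : (m : ℝ) * (ℓ / m) = ℓ := by field_simp
        linarith
      refine ⟨⟨⌊(x i - a i) / (ℓ / m)⌋₊, (Nat.floor_lt h3).2 h4⟩, ?_⟩
      have h5 := Nat.floor_le h3
      have h6 := (Nat.lt_floor_add_one ((x i - a i) / (ℓ / m))).le
      rw [le_div_iff₀ (by positivity)] at h5
      rw [div_le_iff₀ (by positivity)] at h6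
      have : 0 < ℓ / m := by positivity
      rw [abs_le]
      constructor <;> simp only <;> nlinarith
    choose j hj using hfl
    have hmem : pt j ∈ ((Finset.univ.image pt : Finset _) : Set (EuclideanSpace ℝ (Fin d))) := by
      simp
    refine (infDist_le_dist_of_mem hmem).trans ?_
    rw [EuclideanSpace.dist_eq]
    have : ∑ i, dist (x i) (pt j i) ^ 2 ≤ d * (ℓ / m) ^ 2 := by
      calc ∑ i, dist (x i) (pt j i) ^ 2 ≤ ∑ _i : Fin d, (ℓ / m) ^ 2 := by
            refine Finset.sum_le_sum fun i _ => ?_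
            have := hj i
            rw [Real.dist_eq]
            gcongr
        _ = _ := by simp
    calc √(∑ i, dist (x i) (pt j i) ^ 2) ≤ √(d * (ℓ / m) ^ 2) := Real.sqrt_le_sqrt this
      _ = _ := by rw [Real.sqrt_mul (by positivity), Real.sqrt_sq (by positivity)]

/-- The closed box obtained from `box a ℓ` by removing a layer of width `D`. -/
def innerBox {d : ℕ} (a : EuclideanSpace ℝ (Fin d)) (ℓ D : ℝ) : Set (EuclideanSpace ℝ (Fin d)) :=
  {x | ∀ i, x i ∈ Icc (a i + D) (a i + ℓ - D)}

theorem measurableSet_innerBox {d : ℕ} (a : EuclideanSpace ℝ (Fin d)) (ℓ D : ℝ) :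
    MeasurableSet (innerBox a ℓ D) :=
  measurableSet_setOf_forall_mem _ fun _ => measurableSet_Icc

theorem volume_innerBox {d : ℕ} (a : EuclideanSpace ℝ (Fin d)) (ℓ D : ℝ) :
    volume (innerBox a ℓ D) = ENNReal.ofReal (ℓ - 2 * D) ^ d := by
  unfold innerBox
  rw [volume_setOf_forall_mem]
  have h : ∀ i, a i + ℓ - D - (a i + D) = ℓ - 2 * D := fun i => by ring
  simp [Real.volume_Icc, h]

theorem innerBox_subset_box {d : ℕ} (a : EuclideanSpace ℝ (Fin d)) (ℓ : ℝ) {D : ℝ} (hD : 0 < D) :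
    innerBox a ℓ D ⊆ box a ℓ := by
  intro x hx i
  obtain ⟨h1, h2⟩ := hx i
  exact ⟨by linarith, by linarith⟩

theorem qdist_le_of_mem {d : ℕ} {x y : EuclideanSpace ℝ (Fin d)}
    {γ : Finset (EuclideanSpace ℝ (Fin d))} (hy : y ∈ γ) : qdist x γ ≤ dist x y :=
  infDist_le_dist_of_mem (by exact_mod_cast hy)

theorem le_qdist {d : ℕ} {x : EuclideanSpace ℝ (Fin d)} {γ : Finset (EuclideanSpace ℝ (Fin d))}
    (hγ : γ.Nonempty) {D : ℝ} (h : ∀ y ∈ γ, D ≤ dist x y) : D ≤ qdist x γ :=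
  (le_infDist (by exact_mod_cast hγ)).2 fun {y} hy => h y (by exact_mod_cast hy)

theorem le_dist_of_mem_innerBox {d : ℕ} {a x y : EuclideanSpace ℝ (Fin d)} {ℓ D : ℝ}
    (hx : x ∈ innerBox a ℓ D) (hy : y ∉ box a ℓ) : D ≤ dist x y := by
  unfold box at hy
  simp only [mem_ofPred_eq, not_forall] at hy
  obtain ⟨i, hi⟩ := hy
  obtain ⟨h1, h2⟩ := hx i
  have h3 : dist (x i) (y i) ≤ dist x y := by
    rw [dist_eq_norm, dist_eq_norm]
    exact PiLp.norm_apply_le (x - y) i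
  refine le_trans ?_ h3
  rw [Real.dist_eq]
  rw [mem_Ico, not_and_or, not_le, not_lt] at hi
  rcases hi with hi | hi
  · exact le_trans (by linarith) (le_abs_self _)
  · exact le_trans (by linarith) (neg_le_abs _)

/-- Lower bound for the weighted distortion of a codebook on a box, in terms of the number of
code points in the box. -/
theorem box_distortion_lower_bound {d : ℕ} {s : ℝ} (hs : 0 < s) (a : EuclideanSpace ℝ (Fin d))
    {ℓ : ℝ} (hℓ : 0 < ℓ) {m : ℕ} (hm : 1 ≤ m) (hd : 1 ≤ d)
    (α : Finset (EuclideanSpace ℝ (Fin d))) (hα : α.Nonempty)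
    (c : ℝ≥0∞) (g : EuclideanSpace ℝ (Fin d) → ℝ≥0∞) (hg : Measurable g) :
    c * (Jrd s d * (ENNReal.ofReal ℓ ^ d * ENNReal.ofReal ℓ ^ s)) ≤
      (((α.filter (· ∈ box a ℓ)).card + m ^ d : ℕ) : ℝ≥0∞) ^ (s / d) *
      ((∫⁻ x in box a ℓ, g x * ENNReal.ofReal (qdist x α) ^ s) +
        ENNReal.ofReal (√d * (ℓ / m)) ^ s *
          (c * volume (box a ℓ \ innerBox a ℓ (√d * (ℓ / m))) + ∫⁻ x in box a ℓ, (c - g x))) := by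
  set D := √d * (ℓ / m) with hD
  have hD0 : 0 < D := by
    have : (0 : ℝ) < m := by exact_mod_cast hm
    have : (0 : ℝ) < d := by exact_mod_cast hd
    positivity
  obtain ⟨G, hG0, hGc, hG⟩ := exists_grid a hℓ hm
  set γ := α.filter (· ∈ box a ℓ) ∪ G with hγ
  have hγ0 : γ.Nonempty := hG0.mono Finset.subset_union_right
  have hγc : γ.card ≤ (α.filter (· ∈ box a ℓ)).card + m ^ d :=
    (Finset.card_union_le _ _).trans (by gcongr)
  have hγD : ∀ x ∈ box a ℓ, qdist x γ ≤ D := by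
    intro x hx
    refine le_trans ?_ (hG x hx)
    exact infDist_le_infDist_of_subset (by rw [hγ]; push_cast; exact subset_union_right)
      (by exact_mod_cast hG0)
  have hγα : ∀ x ∈ innerBox a ℓ D, qdist x γ ≤ qdist x α := by
    intro x hx
    refine le_qdist hα fun y hy => ?_
    by_cases hyb : y ∈ box a ℓ
    · exact qdist_le_of_mem (Finset.mem_union_left _ (Finset.mem_filter.2 ⟨hy, hyb⟩))
    · exact (hγD x (innerBox_subset_box a ℓ hD0 hx)).trans (le_dist_of_mem_innerBox hx hyb)
  have hpt : ∀ x ∈ box a ℓ, c * ENNReal.ofReal (qdist x γ) ^ s ≤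
      g x * ENNReal.ofReal (qdist x α) ^ s + (ENNReal.ofReal D ^ s *
        ((box a ℓ \ innerBox a ℓ D).indicator (fun _ => c) x + (c - g x))) := by
    intro x hx
    have hle : ENNReal.ofReal (qdist x γ) ^ s ≤ ENNReal.ofReal D ^ s := by
      gcongr; exact hγD x hx
    by_cases hxi : x ∈ innerBox a ℓ D
    · have hle2 : ENNReal.ofReal (qdist x γ) ^ s ≤ ENNReal.ofReal (qdist x α) ^ s := by
        gcongr; exact hγα x hxi
      calc c * ENNReal.ofReal (qdist x γ) ^ s
          ≤ (g x + (c - g x)) * ENNReal.ofReal (qdist x γ) ^ s := by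
            gcongr; exact le_add_tsub
        _ = g x * ENNReal.ofReal (qdist x γ) ^ s + ENNReal.ofReal (qdist x γ) ^ s * (c - g x) := by
            ring
        _ ≤ g x * ENNReal.ofReal (qdist x α) ^ s + ENNReal.ofReal D ^ s * (0 + (c - g x)) := by
            rw [zero_add]; gcongr
        _ ≤ _ := by gcongr; exact zero_le
    · rw [indicator_of_mem (show x ∈ box a ℓ \ innerBox a ℓ D from ⟨hx, hxi⟩)]
      calc c * ENNReal.ofReal (qdist x γ) ^ s ≤ c * ENNReal.ofReal D ^ s := by gcongr
        _ = ENNReal.ofReal D ^ s * (c + 0) := by ring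
        _ ≤ ENNReal.ofReal D ^ s * (c + (c - g x)) := by gcongr; exact zero_le
        _ ≤ _ := le_add_self
  have hmeasd : ∀ β : Finset (EuclideanSpace ℝ (Fin d)),
      Measurable fun x => ENNReal.ofReal (qdist x β) ^ s := fun β =>
    ((measurable_qdist β).ennreal_ofReal).pow_const s
  have hmS : MeasurableSet (box a ℓ \ innerBox a ℓ D) :=
    (measurableSet_box a ℓ).diff (measurableSet_innerBox a ℓ D)
  have hint : c * ∫⁻ x in box a ℓ, ENNReal.ofReal (qdist x γ) ^ s ≤
      (∫⁻ x in box a ℓ, g x * ENNReal.ofReal (qdist x α) ^ s) + ENNReal.ofReal D ^ s *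
          (c * volume (box a ℓ \ innerBox a ℓ D) + ∫⁻ x in box a ℓ, (c - g x)) := by
    rw [← lintegral_const_mul _ (hmeasd γ)]
    refine (setLIntegral_mono' (measurableSet_box a ℓ) hpt).trans ?_
    have hmg : Measurable fun x => g x * ENNReal.ofReal (qdist x α) ^ s := hg.mul (hmeasd α)
    have hme : Measurable fun x =>
        (box a ℓ \ innerBox a ℓ D).indicator (fun _ => c) x + (c - g x) :=
      (measurable_const.indicator hmS).add (measurable_const.sub hg)
    rw [lintegral_add_left hmg, lintegral_const_mul _ hme,
      lintegral_add_left (measurable_const.indicator hmS)]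
    gcongr
    rw [lintegral_indicator hmS, setLIntegral_const]
    gcongr
    exact Measure.restrict_le_self
  calc c * (Jrd s d * (ENNReal.ofReal ℓ ^ d * ENNReal.ofReal ℓ ^ s))
      ≤ c * ((((α.filter (· ∈ box a ℓ)).card + m ^ d : ℕ) : ℝ≥0∞) ^ (s / d) *
          ∫⁻ x in box a ℓ, ENNReal.ofReal (qdist x γ) ^ s) :=
        mul_le_mul' le_rfl (Jrd_mul_le_lintegral_box hs a hℓ γ hγ0 hγc)
    _ = (((α.filter (· ∈ box a ℓ)).card + m ^ d : ℕ) : ℝ≥0∞) ^ (s / d) *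
          (c * ∫⁻ x in box a ℓ, ENNReal.ofReal (qdist x γ) ^ s) := by ring
    _ ≤ _ := mul_le_mul' le_rfl hint

theorem Jrd_ne_top {d : ℕ} {s : ℝ} (hs : 0 < s) : Jrd s d ≠ ⊤ := by
  have h := Jrd_le_unifCube (d := d) hs {0} (Finset.singleton_nonempty _) (N := 1) (by simp)
  refine ne_top_of_le_ne_top ?_ h
  simp only [Nat.cast_one, ENNReal.one_rpow, one_mul]
  unfold qerr
  rw [unifCube_eq]
  refine ne_top_of_le_ne_top ?_ (setLIntegral_mono' (g := fun _ => ENNReal.ofReal (√d) ^ s)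
    (measurableSet_box _ _) ?_)
  · rw [setLIntegral_const, volume_box]
    have : ENNReal.ofReal √d ^ s ≠ ⊤ := ENNReal.rpow_ne_top_of_nonneg hs.le (by finiteness)
    finiteness
  · intro x hx
    gcongr
    refine (qdist_le_of_mem (Finset.mem_singleton_self _)).trans ?_
    rw [dist_zero_right, EuclideanSpace.norm_eq]
    apply Real.sqrt_le_sqrt
    calc ∑ i, ‖x i‖ ^ 2 ≤ ∑ _i : Fin d, (1 : ℝ) := by
          refine Finset.sum_le_sum fun i _ => ?_
          obtain ⟨h1, h2⟩ := hx i
          simp only [PiLp.zero_apply, zero_add] at h1 h2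
          rw [Real.norm_of_nonneg h1]
          nlinarith
      _ = d := by simp

theorem Jrd_ne_zero {d : ℕ} (hd : 1 ≤ d) {s : ℝ} (hs : 0 < s) : Jrd s d ≠ 0 := by
  have : Nonempty (Fin d) := ⟨⟨0, hd⟩⟩
  have hd0 : (0 : ℝ) < d := by exact_mod_cast hd
  set ω : ℝ≥0∞ := volume (ball (0 : EuclideanSpace ℝ (Fin d)) 1) with hω
  have hω0 : 0 < ω.toReal := ENNReal.toReal_pos (measure_ball_pos _ _ one_pos).ne' measure_ball_lt_top.ne
  have hωt : ω ≠ ⊤ := measure_ball_lt_top.ne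
  set κ : ℝ := (2 * ω.toReal)⁻¹ with hκ
  have hκ0 : 0 < κ := by positivity
  have key : ENNReal.ofReal κ ^ (s / d) * 2⁻¹ ≤ Jrd s d := by
    unfold Jrd
    refine le_iInf₂ fun n hn => ?_
    have hn0 : (0 : ℝ) < n := by exact_mod_cast hn
    set ρ : ℝ := (κ / n) ^ (1 / (d : ℝ)) with hρ
    have hρ0 : 0 < ρ := by positivity
    have hρd : ρ ^ d = κ / n := by
      rw [hρ, ← Real.rpow_natCast, ← Real.rpow_mul (by positivity)]
      simp [hd0.ne']
    have henr : (ENNReal.ofReal ρ ^ s * 2⁻¹) ^ (1 / s) ≤ enr (unifCube d) s n := by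
      unfold enr
      refine le_iInf fun α => le_iInf fun hα => le_iInf fun hc => ?_
      gcongr
      set B := ⋃ a ∈ α, ball a ρ with hB
      have hBm : MeasurableSet B := Finset.measurableSet_biUnion _ fun _ _ => measurableSet_ball
      have hBv : volume B ≤ 2⁻¹ := by
        calc volume B ≤ ∑ a ∈ α, volume (ball a ρ) := measure_biUnion_finset_le _ _
          _ = ∑ a ∈ α, ENNReal.ofReal (ρ ^ d) * ω := by
            refine Finset.sum_congr rfl fun a _ => ?_
            rw [Measure.addHaar_ball _ _ hρ0.le, finrank_euclideanSpace, Fintype.card_fin]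
          _ = α.card * (ENNReal.ofReal (ρ ^ d) * ω) := by simp
          _ ≤ n * (ENNReal.ofReal (ρ ^ d) * ω) := by gcongr
          _ = ENNReal.ofReal (n * (ρ ^ d * ω.toReal)) := by
            rw [ENNReal.ofReal_mul hn0.le, ENNReal.ofReal_mul (by positivity),
              ENNReal.ofReal_toReal hωt, ENNReal.ofReal_natCast]
          _ = 2⁻¹ := by
            have : n * (ρ ^ d * ω.toReal) = 2⁻¹ := by
              rw [hρd, hκ]; field_simp
            rw [this, ENNReal.ofReal_inv_of_pos two_pos]; simp
      unfold qerr
      rw [unifCube_eq]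
      have hvol : 2⁻¹ ≤ volume (box (0 : EuclideanSpace ℝ (Fin d)) 1 \ B) := by
        have h1 : volume (box (0 : EuclideanSpace ℝ (Fin d)) 1) = 1 := by rw [volume_box]; simp
        refine le_trans ?_ le_measure_sdiff
        rw [h1]
        refine le_trans ?_ (tsub_le_tsub_left hBv 1)
        rw [ENNReal.one_sub_inv_two]
      calc ENNReal.ofReal ρ ^ s * 2⁻¹
          ≤ ENNReal.ofReal ρ ^ s * volume (box (0 : EuclideanSpace ℝ (Fin d)) 1 \ B) := by gcongr
        _ = ∫⁻ x in box (0 : EuclideanSpace ℝ (Fin d)) 1 \ B, ENNReal.ofReal ρ ^ s := by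
          rw [setLIntegral_const]
        _ ≤ ∫⁻ x in box (0 : EuclideanSpace ℝ (Fin d)) 1 \ B, ENNReal.ofReal (qdist x α) ^ s := by
          refine setLIntegral_mono' ((measurableSet_box _ _).diff hBm) fun x hx => ?_
          gcongr
          refine le_qdist hα fun y hy => ?_
          by_contra hlt
          exact hx.2 (mem_biUnion hy (mem_ball.2 (not_le.1 hlt)))
        _ ≤ _ := lintegral_mono_set sdiff_subset
    calc ENNReal.ofReal κ ^ (s / d) * 2⁻¹
        = (n : ℝ≥0∞) ^ (s / (d : ℝ)) * (ENNReal.ofReal ρ ^ s * 2⁻¹) := by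
          rw [← mul_assoc]
          congr 1
          rw [hρ, ← ENNReal.ofReal_rpow_of_pos (by positivity), ← ENNReal.rpow_mul,
            ← ENNReal.ofReal_natCast, one_div_mul_eq_div,
            ← ENNReal.mul_rpow_of_nonneg _ _ (by positivity), ← ENNReal.ofReal_mul hn0.le]
          congr 2
          field_simp
      _ = (n : ℝ≥0∞) ^ (s / (d : ℝ)) * ((ENNReal.ofReal ρ ^ s * 2⁻¹) ^ (1 / s)) ^ s := by
          rw [← ENNReal.rpow_mul, one_div_mul_cancel hs.ne', ENNReal.rpow_one]
      _ ≤ _ := by gcongr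
  refine (lt_of_lt_of_le ?_ key).ne'
  have : 0 < ENNReal.ofReal κ ^ (s / d) :=
    ENNReal.rpow_pos (ENNReal.ofReal_pos.2 hκ0) ENNReal.ofReal_ne_top
  exact ENNReal.mul_pos this.ne' (by simp)

/-- The limit of a sequence in `ℝ≥0∞` along an ultrafilter. -/
def ulim (U : Ultrafilter ℕ) (a : ℕ → ℝ≥0∞) : ℝ≥0∞ := (U.map a).lim

theorem tendsto_ulim (U : Ultrafilter ℕ) (a : ℕ → ℝ≥0∞) : Tendsto a U (𝓝 (ulim U a)) :=
  (U.map a).le_nhds_lim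

theorem ulim_mono {U : Ultrafilter ℕ} {a b : ℕ → ℝ≥0∞} (h : ∀ᶠ n in (U : Filter ℕ), a n ≤ b n) :
    ulim U a ≤ ulim U b :=
  le_of_tendsto_of_tendsto (tendsto_ulim U a) (tendsto_ulim U b) h

theorem ulim_eq_of_tendsto {U : Ultrafilter ℕ} {a : ℕ → ℝ≥0∞} {l : ℝ≥0∞}
    (h : Tendsto a U (𝓝 l)) : ulim U a = l :=
  tendsto_nhds_unique (tendsto_ulim U a) h

theorem tsum_ulim_le {ι : Type*} {U : Ultrafilter ℕ} {a : ι → ℕ → ℝ≥0∞} {b : ℕ → ℝ≥0∞}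
    (h : ∀ᶠ n in (U : Filter ℕ), ∑' i, a i n ≤ b n) : ∑' i, ulim U (a i) ≤ ulim U b := by
  rw [ENNReal.tsum_eq_iSup_sum]
  refine iSup_le fun S => ?_
  refine le_of_tendsto_of_tendsto (tendsto_finsetSum S fun i _ => tendsto_ulim U (a i))
    (tendsto_ulim U b) ?_
  filter_upwards [h] with n hn
  exact (ENNReal.sum_le_tsum S).trans hn

/-- The limiting proportion of code points in a set `A`, along an ultrafilter. -/
def dens {d : ℕ} (U : Ultrafilter ℕ) (α : ℕ → Finset (EuclideanSpace ℝ (Fin d)))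
    (A : Set (EuclideanSpace ℝ (Fin d))) : ℝ≥0∞ :=
  ulim U fun n => ((α n).filter (· ∈ A)).card / (n : ℝ≥0∞)

/-- The limit along an ultrafilter of the normalized distortion on a set `A` with weight `g`. -/
def locErr {d : ℕ} (U : Ultrafilter ℕ) (α : ℕ → Finset (EuclideanSpace ℝ (Fin d))) (s : ℝ)
    (g : EuclideanSpace ℝ (Fin d) → ℝ≥0∞) (A : Set (EuclideanSpace ℝ (Fin d))) : ℝ≥0∞ :=
  ulim U fun n => (n : ℝ≥0∞) ^ (s / d) * ∫⁻ x in A, g x * ENNReal.ofReal (qdist x (α n)) ^ s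

theorem tsum_dens_le {d : ℕ} {ι : Type*} (U : Ultrafilter ℕ)
    (α : ℕ → Finset (EuclideanSpace ℝ (Fin d))) (A : ι → Set (EuclideanSpace ℝ (Fin d)))
    (B : Set (EuclideanSpace ℝ (Fin d))) (hA : Pairwise (Function.onFun Disjoint A))
    (hAB : ∀ i, A i ⊆ B) : ∑' i, dens U α (A i) ≤ dens U α B := by
  refine tsum_ulim_le (.of_forall fun n => ?_)
  simp only [div_eq_mul_inv]
  rw [ENNReal.tsum_mul_right]
  gcongr
  rw [ENNReal.tsum_eq_iSup_sum]
  refine iSup_le fun S => ?_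
  rw [← Nat.cast_sum, ← Finset.card_biUnion]
  · gcongr
    intro x hx
    simp only [Finset.mem_biUnion, Finset.mem_filter] at hx ⊢
    obtain ⟨i, _, h1, h2⟩ := hx
    exact ⟨h1, hAB i h2⟩
  · intro i _ j _ hij
    refine Finset.disjoint_left.2 ?_
    intro x hx hy
    exact Set.disjoint_left.1 (hA hij) (Finset.mem_filter.1 hx).2 (Finset.mem_filter.1 hy).2

theorem dens_le_one {d : ℕ} {U : Ultrafilter ℕ} (hU : (U : Filter ℕ) ≤ atTop)
    {α : ℕ → Finset (EuclideanSpace ℝ (Fin d))} (hα : ∀ n, 1 ≤ n → (α n).Nonempty ∧ (α n).card ≤ n)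
    (A : Set (EuclideanSpace ℝ (Fin d))) : dens U α A ≤ 1 := by
  rw [← ulim_eq_of_tendsto (U := U) (tendsto_const_nhds (x := (1 : ℝ≥0∞)))]
  refine ulim_mono (hU ?_)
  filter_upwards [eventually_ge_atTop 1] with n hn
  refine ENNReal.div_le_of_le_mul ?_
  rw [one_mul]
  exact_mod_cast (Finset.card_filter_le _ _).trans (hα n hn).2

theorem tsum_locErr_le {d : ℕ} {ι : Type*} [Countable ι] (U : Ultrafilter ℕ)
    (α : ℕ → Finset (EuclideanSpace ℝ (Fin d))) (s : ℝ)
    (g : EuclideanSpace ℝ (Fin d) → ℝ≥0∞) (A : ι → Set (EuclideanSpace ℝ (Fin d)))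
    (hAm : ∀ i, MeasurableSet (A i)) (hA : Pairwise (Function.onFun Disjoint A))
    (B : Set (EuclideanSpace ℝ (Fin d))) (hAB : ∀ i, A i ⊆ B) :
    ∑' i, locErr U α s g (A i) ≤ locErr U α s g B := by
  refine tsum_ulim_le (.of_forall fun n => ?_)
  rw [ENNReal.tsum_mul_left, ← lintegral_iUnion hAm hA]
  gcongr
  exact iUnion_subset hAB

theorem tendsto_volume_box_diff_innerBox {d : ℕ} (a : EuclideanSpace ℝ (Fin d)) (ℓ : ℝ) :
    Tendsto (fun D => volume (box a ℓ \ innerBox a ℓ D)) (𝓝[>] 0) (𝓝 0) := by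
  have h1 : Tendsto (fun D : ℝ => ENNReal.ofReal ℓ ^ d - ENNReal.ofReal (ℓ - 2 * D) ^ d) (𝓝[>] 0)
      (𝓝 (ENNReal.ofReal ℓ ^ d - ENNReal.ofReal ℓ ^ d)) := by
    refine ENNReal.Tendsto.sub tendsto_const_nhds (ENNReal.Tendsto.pow ?_) (Or.inl (by finiteness))
    refine ENNReal.tendsto_ofReal ?_
    have : Tendsto (fun D : ℝ => ℓ - 2 * D) (𝓝 0) (𝓝 (ℓ - 2 * 0)) := by
      apply Continuous.tendsto; fun_prop
    rw [mul_zero, sub_zero] at this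
    exact this.mono_left nhdsWithin_le_nhds
  rw [tsub_self] at h1
  refine h1.congr' ?_
  filter_upwards [self_mem_nhdsWithin] with D hD
  rw [measure_sdiff (innerBox_subset_box a ℓ hD) (measurableSet_innerBox a ℓ D).nullMeasurableSet,
    volume_box, volume_innerBox]
  rw [volume_innerBox]
  finiteness

theorem exists_grid_size {d : ℕ} (hd : 1 ≤ d) {ε : ℝ} (hε : 0 < ε) :
    ∃ m : ℕ → ℕ, Tendsto m atTop atTop ∧ ∀ᶠ n : ℕ in atTop, 1 ≤ m n ∧ (m n : ℝ) ^ d ≤ ε * n ∧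
      (ε * n) ^ (1 / (d : ℝ)) ≤ 2 * m n := by
  have hd0 : (0 : ℝ) < d := by exact_mod_cast hd
  have hy : Tendsto (fun n : ℕ => (ε * n) ^ (1 / (d : ℝ))) atTop atTop :=
    (tendsto_rpow_atTop (by positivity)).comp (tendsto_natCast_atTop_atTop.const_mul_atTop hε)
  refine ⟨fun n => ⌈(ε * n) ^ (1 / (d : ℝ)) / 2⌉₊,
    tendsto_nat_ceil_atTop.comp (hy.atTop_div_const two_pos), ?_⟩
  filter_upwards [hy.eventually_ge_atTop 2] with n hn
  set y := (ε * n) ^ (1 / (d : ℝ)) with hydef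
  have h1 : (⌈y / 2⌉₊ : ℝ) ≤ y := by
    have := (Nat.ceil_lt_add_one (show 0 ≤ y / 2 by linarith)).le
    linarith
  have h2 := Nat.le_ceil (y / 2)
  refine ⟨Nat.one_le_iff_ne_zero.2 fun h => ?_, ?_, by linarith⟩
  · rw [h] at h2; norm_num at h2; linarith
  · calc (⌈y / 2⌉₊ : ℝ) ^ d ≤ y ^ d := by gcongr
      _ = ε * n := by
        rw [hydef, ← Real.rpow_natCast, ← Real.rpow_mul (by positivity)]
        simp [hd0.ne']

theorem box_locErr_lower_bound_aux {d : ℕ} (hd : 1 ≤ d) {s : ℝ} (hs : 0 < s)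
    {U : Ultrafilter ℕ} (hU : (U : Filter ℕ) ≤ atTop)
    {α : ℕ → Finset (EuclideanSpace ℝ (Fin d))} (hα : ∀ n, 1 ≤ n → (α n).Nonempty ∧ (α n).card ≤ n)
    (a : EuclideanSpace ℝ (Fin d)) {ℓ : ℝ} (hℓ : 0 < ℓ) {ε : ℝ} (hε : 0 < ε)
    {c : ℝ≥0∞} (hc : c ≠ ⊤) (g : EuclideanSpace ℝ (Fin d) → ℝ≥0∞) (hg : Measurable g) :
    c * (Jrd s d * (ENNReal.ofReal ℓ ^ d * ENNReal.ofReal ℓ ^ s)) ≤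
      (dens U α (box a ℓ) + ENNReal.ofReal ε) ^ (s / d) *
      (locErr U α s g (box a ℓ) + ENNReal.ofReal (2 * √d * ℓ) ^ s * ENNReal.ofReal ε ^ (-(s / d)) *
        ∫⁻ x in box a ℓ, (c - g x)) := by
  have hd0 : (0 : ℝ) < d := by exact_mod_cast hd
  have hp : 0 < s / d := by positivity
  obtain ⟨m, hm, hm'⟩ := exists_grid_size hd hε
  set K := ENNReal.ofReal (2 * √d * ℓ) ^ s * ENNReal.ofReal ε ^ (-(s / d)) with hK
  have hKt : K ≠ ⊤ := by
    refine ENNReal.mul_ne_top (ENNReal.rpow_ne_top_of_nonneg hs.le (by finiteness)) ?_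
    exact ENNReal.rpow_ne_top_of_ne_zero (by simpa using hε) (by finiteness)
  set E := ∫⁻ x in box a ℓ, (c - g x) with hE
  let D : ℕ → ℝ := fun n => √d * (ℓ / m n)
  have hD : Tendsto D U (𝓝[>] 0) := by
    rw [tendsto_nhdsWithin_iff]
    constructor
    · have : Tendsto D atTop (𝓝 (√d * 0)) :=
        ((tendsto_natCast_atTop_atTop.comp hm).const_div_atTop ℓ).const_mul _
      rw [mul_zero] at this
      exact this.mono_left hU
    · refine hU ?_
      filter_upwards [hm'] with n hn
      have : (0 : ℝ) < m n := by exact_mod_cast hn.1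
      simp only [D, mem_Ioi]
      positivity
  have hlayer := (tendsto_volume_box_diff_innerBox a ℓ).comp hD
  have hlim : Tendsto (fun n : ℕ =>
      (((α n).filter (· ∈ box a ℓ)).card / (n : ℝ≥0∞) + ENNReal.ofReal ε) ^ (s / d) *
      (((n : ℝ≥0∞) ^ (s / d) * ∫⁻ x in box a ℓ, g x * ENNReal.ofReal (qdist x (α n)) ^ s) +
        K * (c * volume (box a ℓ \ innerBox a ℓ (D n)) + E))) U
      (𝓝 ((dens U α (box a ℓ) + ENNReal.ofReal ε) ^ (s / d) *
      (locErr U α s g (box a ℓ) + K * (c * 0 + E)))) := by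
    have hne0 : (dens U α (box a ℓ) + ENNReal.ofReal ε) ^ (s / d) ≠ 0 := by
      rw [Ne, ENNReal.rpow_eq_zero_iff]
      have : ENNReal.ofReal ε ≠ 0 := by simpa using hε
      simp only [add_eq_zero, this, and_false, false_and, false_or, not_and, not_lt]
      exact fun _ => hp.le
    have hnet : (dens U α (box a ℓ) + ENNReal.ofReal ε) ^ (s / d) ≠ ⊤ := by
      refine ENNReal.rpow_ne_top_of_nonneg hp.le ?_
      have := ne_top_of_le_ne_top ENNReal.one_ne_top (dens_le_one hU hα (box a ℓ))
      finiteness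
    refine ENNReal.Tendsto.mul ?_ (Or.inl hne0) ?_ (Or.inr hnet)
    · exact ((tendsto_ulim U _).add tendsto_const_nhds).ennrpow_const _
    · refine (tendsto_ulim U _).add ?_
      refine ENNReal.Tendsto.const_mul ?_ (Or.inr hKt)
      exact (ENNReal.Tendsto.const_mul hlayer (Or.inr hc)).add tendsto_const_nhds
  rw [mul_zero, zero_add] at hlim
  refine ge_of_tendsto hlim (hU ?_)
  filter_upwards [hm', eventually_ge_atTop 1] with n hn hn1
  obtain ⟨hm1, hmd, hmy⟩ := hn
  have hn0 : (0 : ℝ) < n := by exact_mod_cast hn1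
  have hm0 : (0 : ℝ) < m n := by exact_mod_cast hm1
  have hnz : (n : ℝ≥0∞) ≠ 0 := by exact_mod_cast (by omega : n ≠ 0)
  refine (box_distortion_lower_bound hs a hℓ hm1 hd (α n) (hα n hn1).1 c g hg).trans ?_
  have h1 : ((((α n).filter (· ∈ box a ℓ)).card + m n ^ d : ℕ) : ℝ≥0∞) ≤
      (((α n).filter (· ∈ box a ℓ)).card / (n : ℝ≥0∞) + ENNReal.ofReal ε) * n := by
    rw [add_mul, ENNReal.div_mul_cancel hnz (by finiteness)]
    push_cast
    gcongr
    rw [← ENNReal.ofReal_natCast (n := n), ← ENNReal.ofReal_mul hε.le,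
      ← ENNReal.ofReal_natCast (n := m n), ← ENNReal.ofReal_pow hm0.le]
    exact ENNReal.ofReal_le_ofReal hmd
  have h2 : (n : ℝ≥0∞) ^ (s / d) * ENNReal.ofReal (D n) ^ s ≤ K := by
    have h3 : D n ≤ 2 * √d * ℓ * (ε * n) ^ (-(1 / (d : ℝ))) := by
      simp only [D]
      rw [Real.rpow_neg (by positivity), ← div_eq_mul_inv, ← mul_div_assoc,
        div_le_div_iff₀ hm0 (by positivity)]
      have : 0 ≤ √d * ℓ := by positivity
      nlinarith
    calc (n : ℝ≥0∞) ^ (s / d) * ENNReal.ofReal (D n) ^ s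
        ≤ (n : ℝ≥0∞) ^ (s / d) *
          ENNReal.ofReal (2 * √d * ℓ * (ε * n) ^ (-(1 / (d : ℝ)))) ^ s := by gcongr
      _ = K := by
        rw [ENNReal.ofReal_mul (by positivity), ENNReal.mul_rpow_of_nonneg _ _ hs.le, mul_left_comm]
        congr 1
        rw [← ENNReal.ofReal_natCast, ENNReal.ofReal_rpow_of_pos hn0,
          ENNReal.ofReal_rpow_of_pos (by positivity), ENNReal.ofReal_rpow_of_pos hε,
          ← ENNReal.ofReal_mul (by positivity)]
        congr 1
        rw [← Real.rpow_mul (by positivity), Real.mul_rpow hε.le hn0.le, mul_left_comm,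
          ← Real.rpow_add hn0]
        have h4 : -(1 / (d : ℝ)) * s = -(s / d) := by ring
        rw [h4]
        simp
  calc _ ≤ ((((α n).filter (· ∈ box a ℓ)).card / (n : ℝ≥0∞) + ENNReal.ofReal ε) * n) ^ (s / d) *
      ((∫⁻ x in box a ℓ, g x * ENNReal.ofReal (qdist x (α n)) ^ s) + ENNReal.ofReal (D n) ^ s *
          (c * volume (box a ℓ \ innerBox a ℓ (D n)) + E)) := by
        refine mul_le_mul' ?_ le_rfl
        exact ENNReal.rpow_le_rpow h1 hp.le
    _ = (((α n).filter (· ∈ box a ℓ)).card / (n : ℝ≥0∞) + ENNReal.ofReal ε) ^ (s / d) *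
      (((n : ℝ≥0∞) ^ (s / d) * ∫⁻ x in box a ℓ, g x * ENNReal.ofReal (qdist x (α n)) ^ s) +
        (n : ℝ≥0∞) ^ (s / d) * ENNReal.ofReal (D n) ^ s *
          (c * volume (box a ℓ \ innerBox a ℓ (D n)) + E)) := by
        rw [ENNReal.mul_rpow_of_nonneg _ _ hp.le]
        ring
    _ ≤ _ := by gcongr

theorem box_locErr_lower_bound {d : ℕ} (hd : 1 ≤ d) {s : ℝ} (hs : 0 < s)
    {U : Ultrafilter ℕ} (hU : (U : Filter ℕ) ≤ atTop)
    {α : ℕ → Finset (EuclideanSpace ℝ (Fin d))} (hα : ∀ n, 1 ≤ n → (α n).Nonempty ∧ (α n).card ≤ n)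
    (a : EuclideanSpace ℝ (Fin d)) {ℓ : ℝ} (hℓ : 0 < ℓ) {ε : ℝ} (hε : 0 < ε)
    {c : ℝ≥0∞} (hc : c ≠ ⊤) (g : EuclideanSpace ℝ (Fin d) → ℝ≥0∞) (hg : Measurable g) :
    Jrd s d * (c * (dens U α (box a ℓ) / ENNReal.ofReal ℓ ^ d + ENNReal.ofReal ε) ^ (-(s / d)) *
        ENNReal.ofReal ℓ ^ d) ≤
      locErr U α s g (box a ℓ) + ENNReal.ofReal (2 * √d) ^ s * ENNReal.ofReal ε ^ (-(s / d)) *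
        ∫⁻ x in box a ℓ, (c - g x) := by
  have hd0 : (0 : ℝ) < d := by exact_mod_cast hd
  have hp : 0 < s / d := by positivity
  have h := box_locErr_lower_bound_aux hd hs hU hα a hℓ (show 0 < ε * ℓ ^ d by positivity) hc g hg
  set V := ENNReal.ofReal ℓ ^ d with hV
  have hℓ' : ENNReal.ofReal ℓ ≠ 0 := by simpa using hℓ
  have hV0 : V ≠ 0 := pow_ne_zero _ hℓ'
  have hVt : V ≠ ⊤ := by finiteness
  set S := ENNReal.ofReal ℓ ^ s with hS
  have hS0 : S ≠ 0 := (ENNReal.rpow_pos (pos_iff_ne_zero.2 hℓ') (by finiteness)).ne'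
  have hSt : S ≠ ⊤ := ENNReal.rpow_ne_top_of_nonneg hs.le (by finiteness)
  have hVp : V ^ (s / d) = S := by
    rw [hV, hS, ← ENNReal.rpow_natCast, ← ENNReal.rpow_mul]
    congr 1
    field_simp
  have hε' : ENNReal.ofReal (ε * ℓ ^ d) = V * ENNReal.ofReal ε := by
    rw [ENNReal.ofReal_mul hε.le, ENNReal.ofReal_pow hℓ.le, mul_comm]
  set y := dens U α (box a ℓ) / V + ENNReal.ofReal ε with hy
  have hεz : ENNReal.ofReal ε ≠ 0 := by simpa using hε
  have hy0 : y ≠ 0 := by rw [hy]; simp [hεz]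
  have hyt : y ≠ ⊤ := by
    have := ne_top_of_le_ne_top ENNReal.one_ne_top (dens_le_one hU hα (box a ℓ))
    have := ENNReal.div_ne_top this hV0
    finiteness
  have hVy : dens U α (box a ℓ) + ENNReal.ofReal (ε * ℓ ^ d) = V * y := by
    rw [hε', hy, mul_add, ENNReal.mul_div_cancel hV0 hVt]
  have hK : ENNReal.ofReal (2 * √d * ℓ) ^ s * ENNReal.ofReal (ε * ℓ ^ d) ^ (-(s / d)) =
      ENNReal.ofReal (2 * √d) ^ s * ENNReal.ofReal ε ^ (-(s / d)) := by
    rw [ENNReal.ofReal_mul (by positivity), ENNReal.mul_rpow_of_nonneg _ _ hs.le, hε',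
      ENNReal.mul_rpow_of_ne_zero hV0 hεz, ENNReal.rpow_neg V, hVp]
    calc _ = ENNReal.ofReal (2 * √d) ^ s * (S * S⁻¹) * ENNReal.ofReal ε ^ (-(s / d)) := by ring
      _ = _ := by rw [ENNReal.mul_inv_cancel hS0 hSt, mul_one]
  rw [hVy, hK, ENNReal.mul_rpow_of_nonneg _ _ hp.le, hVp] at h
  set R := locErr U α s g (box a ℓ) + ENNReal.ofReal (2 * √d) ^ s * ENNReal.ofReal ε ^ (-(s / d)) *
        ∫⁻ x in box a ℓ, (c - g x) with hR
  have hyp0 : y ^ (s / d) ≠ 0 := (ENNReal.rpow_pos (pos_iff_ne_zero.2 hy0) hyt).ne'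
  have hypt : y ^ (s / d) ≠ ⊤ := ENNReal.rpow_ne_top_of_nonneg hp.le hyt
  have h2 : (S * y ^ (s / d)) * (Jrd s d * (c * y ^ (-(s / d)) * V)) ≤ (S * y ^ (s / d)) * R := by
    calc _ = c * (Jrd s d * (V * S)) * (y ^ (s / d) * (y ^ (s / d))⁻¹) := by
          rw [ENNReal.rpow_neg]; ring
      _ = c * (Jrd s d * (V * S)) := by rw [ENNReal.mul_inv_cancel hyp0 hypt, mul_one]
      _ ≤ _ := h
  exact (ENNReal.mul_le_mul_iff_right (mul_ne_zero hS0 hyp0) (ENNReal.mul_ne_top hSt hypt)).1 h2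

/-- The multi-index of the dyadic cube of generation `k` containing `x`. -/
def cell {d : ℕ} (k : ℕ) (x : EuclideanSpace ℝ (Fin d)) : Fin d → ℤ := fun i => ⌊2 ^ k * x i⌋

/-- The lower corner of the dyadic cube with generation `k` and multi-index `z`. -/
def corner {d : ℕ} (k : ℕ) (z : Fin d → ℤ) : EuclideanSpace ℝ (Fin d) :=
  WithLp.toLp 2 fun i => z i / 2 ^ k

/-- The half-open dyadic cube with generation `k` and multi-index `z`. -/
def cube {d : ℕ} (k : ℕ) (z : Fin d → ℤ) : Set (EuclideanSpace ℝ (Fin d)) :=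
  box (corner k z) (2 ^ k)⁻¹

theorem mem_cube_iff {d : ℕ} {k : ℕ} {z : Fin d → ℤ} {x : EuclideanSpace ℝ (Fin d)} :
    x ∈ cube k z ↔ cell k x = z := by
  have h2 : (0 : ℝ) < 2 ^ k := by positivity
  unfold cube box cell corner
  rw [funext_iff, mem_ofPred_eq]
  refine forall_congr' fun i => ?_
  rw [Int.floor_eq_iff, mem_Ico, div_le_iff₀ h2, ← one_div, ← add_div, lt_div_iff₀ h2, mul_comm]

theorem mem_cube_cell {d : ℕ} (k : ℕ) (x : EuclideanSpace ℝ (Fin d)) : x ∈ cube k (cell k x) :=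
  mem_cube_iff.2 rfl

theorem measurableSet_cube {d : ℕ} (k : ℕ) (z : Fin d → ℤ) : MeasurableSet (cube k z) :=
  measurableSet_box _ _

theorem pairwise_disjoint_cube {d : ℕ} (k : ℕ) :
    Pairwise (Function.onFun Disjoint (cube k : (Fin d → ℤ) → Set (EuclideanSpace ℝ (Fin d)))) := by
  intro z w hzw
  refine Set.disjoint_left.2 fun x hx hy => hzw ?_
  rw [← mem_cube_iff.1 hx, ← mem_cube_iff.1 hy]

theorem iUnion_cube {d : ℕ} (k : ℕ) :
    ⋃ z, cube k z = (univ : Set (EuclideanSpace ℝ (Fin d))) :=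
  eq_univ_of_forall fun x => mem_iUnion.2 ⟨_, mem_cube_cell k x⟩

theorem measurable_cell {d : ℕ} (k : ℕ) :
    Measurable (cell k : EuclideanSpace ℝ (Fin d) → Fin d → ℤ) := by
  unfold cell
  exact measurable_pi_lambda _ fun i => Int.measurable_floor.comp (by fun_prop)

/-- The volume of a dyadic cube of generation `k` in dimension `d`. -/
def cubeVol (d k : ℕ) : ℝ≥0∞ := ENNReal.ofReal (2 ^ k)⁻¹ ^ d

theorem volume_cube {d : ℕ} (k : ℕ) (z : Fin d → ℤ) : volume (cube k z) = cubeVol d k :=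
  volume_box _ _

theorem cubeVol_ne_zero (d k : ℕ) : cubeVol d k ≠ 0 :=
  pow_ne_zero _ (by simp)

theorem cubeVol_ne_top (d k : ℕ) : cubeVol d k ≠ ⊤ := by
  unfold cubeVol; finiteness

theorem cell_eq_of_le {d : ℕ} {k₀ k : ℕ} (hk : k₀ ≤ k) {x y : EuclideanSpace ℝ (Fin d)}
    (h : cell k x = cell k y) : cell k₀ x = cell k₀ y := by
  have key : ∀ x : EuclideanSpace ℝ (Fin d), ∀ i,
      cell k₀ x i = cell k x i / (2 ^ (k - k₀) : ℕ) := by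
    intro x i
    unfold cell
    rw [← Int.floor_div_natCast]
    congr 1
    rw [← Nat.sub_add_cancel hk, Nat.add_sub_cancel, pow_add]
    push_cast
    field_simp
  funext i
  rw [key, key, h]

theorem tsum_setLIntegral_cube {d : ℕ} (k : ℕ) (F : EuclideanSpace ℝ (Fin d) → ℝ≥0∞) :
    ∑' z, ∫⁻ x in cube k z, F x = ∫⁻ x, F x := by
  rw [← lintegral_iUnion (measurableSet_cube k) (pairwise_disjoint_cube k), iUnion_cube,
    setLIntegral_univ]

theorem lintegral_comp_cell {d : ℕ} (k : ℕ) (φ : (Fin d → ℤ) → ℝ≥0∞) :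
    ∫⁻ x : EuclideanSpace ℝ (Fin d), φ (cell k x) = ∑' z, φ z * cubeVol d k := by
  rw [← tsum_setLIntegral_cube k]
  refine tsum_congr fun z => ?_
  rw [setLIntegral_congr_fun (g := fun _ => φ z) (measurableSet_cube k z)
    fun x hx => by simp only [mem_cube_iff.1 hx], setLIntegral_const, volume_cube]

/-- The average of `g` over the dyadic cube of generation `k` containing `x`. -/
def avg {d : ℕ} (k : ℕ) (g : EuclideanSpace ℝ (Fin d) → ℝ≥0∞) (x : EuclideanSpace ℝ (Fin d)) :
    ℝ≥0∞ := (∫⁻ y in cube k (cell k x), g y) / cubeVol d k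

theorem measurable_avg {d : ℕ} (k : ℕ) (g : EuclideanSpace ℝ (Fin d) → ℝ≥0∞) :
    Measurable (avg k g) :=
  (measurable_of_countable fun z : Fin d → ℤ => (∫⁻ y in cube k z, g y) / cubeVol d k).comp
    (measurable_cell k)

theorem lintegral_avg {d : ℕ} (k : ℕ) (g : EuclideanSpace ℝ (Fin d) → ℝ≥0∞) :
    ∫⁻ x, avg k g x = ∫⁻ x, g x := by
  unfold avg
  rw [lintegral_comp_cell k fun z => (∫⁻ y in cube k z, g y) / cubeVol d k,
    ← tsum_setLIntegral_cube k g]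
  exact tsum_congr fun z => ENNReal.div_mul_cancel (cubeVol_ne_zero d k) (cubeVol_ne_top d k)

theorem dist_le_of_mem_closedCube {d : ℕ} (a : EuclideanSpace ℝ (Fin d)) {ℓ : ℝ} (hℓ : 0 ≤ ℓ)
    {x y : EuclideanSpace ℝ (Fin d)} (hx : ∀ i, x i ∈ Icc (a i) (a i + ℓ))
    (hy : ∀ i, y i ∈ Icc (a i) (a i + ℓ)) : dist x y ≤ √d * ℓ := by
  rw [EuclideanSpace.dist_eq]
  calc √(∑ i, dist (x i) (y i) ^ 2) ≤ √(∑ _i : Fin d, ℓ ^ 2) := by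
        gcongr with i
        rw [Real.dist_eq, abs_le]
        have := hx i
        have := hy i
        simp only [mem_Icc] at *
        constructor <;> linarith
    _ = √d * ℓ := by simp [Real.sqrt_sq hℓ]

theorem ae_tendsto_avg {d : ℕ} (g : EuclideanSpace ℝ (Fin d) → ℝ≥0∞) (hg : Measurable g)
    (hgi : ∫⁻ x, g x ≠ ⊤) : ∀ᵐ x, Tendsto (fun k => avg k g x) atTop (𝓝 (g x)) := by
  set B := volume (ball (0 : EuclideanSpace ℝ (Fin d)) 1) with hB
  have hBt : B ≠ ⊤ := measure_ball_lt_top.ne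
  obtain ⟨C, hC⟩ : ∃ C : NNReal, (C : ℝ≥0∞) = ENNReal.ofReal ((3 * √d) ^ d) * B + 3 ^ d :=
    ⟨(ENNReal.ofReal ((3 * √d) ^ d) * B + 3 ^ d).toNNReal, ENNReal.coe_toNNReal (by finiteness)⟩
  have hball : ∀ (x : EuclideanSpace ℝ (Fin d)) (ρ : ℝ), 0 ≤ ρ →
      volume (closedBall x ρ) = ENNReal.ofReal (ρ ^ d) * B := by
    intro x ρ hρ
    rw [Measure.addHaar_closedBall _ _ hρ]
    simp [hB]
  have hdoub : ∀ x : EuclideanSpace ℝ (Fin d), ∃ᶠ ρ in 𝓝[>] (0 : ℝ),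
      volume (closedBall x (3 * ρ)) ≤ C * volume (closedBall x ρ) := by
    intro x
    refine Eventually.frequently ?_
    filter_upwards [self_mem_nhdsWithin] with ρ hρ
    have hρ' : 0 ≤ ρ := (mem_Ioi.1 hρ).le
    rw [hball _ _ (by positivity), hball _ _ hρ', ← mul_assoc, mul_pow,
      ENNReal.ofReal_mul (by positivity), hC]
    gcongr
    rw [ENNReal.ofReal_pow (by norm_num)]
    simp
  let v := Vitali.vitaliFamily (volume : Measure (EuclideanSpace ℝ (Fin d))) C hdoub
  let Q : ℕ → EuclideanSpace ℝ (Fin d) → Set (EuclideanSpace ℝ (Fin d)) := fun k x =>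
    {y | ∀ i, y i ∈ Icc (corner k (cell k x) i) (corner k (cell k x) i + (2 ^ k)⁻¹)}
  have hvol : ∀ k x, volume (Q k x) = cubeVol d k := by
    intro k x
    simp only [Q]
    rw [volume_setOf_forall_mem]
    simp [cubeVol]
  have hsub : ∀ k x, cube k (cell k x) ⊆ Q k x := fun k x y hy i => ⟨(hy i).1, (hy i).2.le⟩
  have hQ : ∀ k x, Q k x =ᵐ[volume] cube k (cell k x) := by
    intro k x
    refine (ae_eq_of_subset_of_measure_ge (hsub k x) ?_
      (measurableSet_cube _ _).nullMeasurableSet ?_).symm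
    · rw [hvol, volume_cube]
    · rw [hvol]; exact cubeVol_ne_top d k
  have hQball : ∀ k x, Q k x ⊆ closedBall x (√d * (2 ^ k)⁻¹) := by
    intro k x y hy
    exact dist_le_of_mem_closedCube _ (by positivity) hy (hsub k x (mem_cube_cell k x))
  filter_upwards [v.ae_tendsto_lintegral_div hg.aemeasurable hgi] with x hx
  have hlim : Tendsto (fun k => Q k x) atTop (v.filterAt x) := by
    rw [VitaliFamily.tendsto_filterAt_iff]
    constructor
    · refine .of_forall fun k => ⟨?_, ?_, √d * (2 ^ k)⁻¹, hQball k x, ?_⟩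
      · simp only [Q]
        rw [ofPred_forall]
        exact isClosed_iInter fun i => isClosed_Icc.preimage (by fun_prop)
      · refine ⟨corner k (cell k x) + WithLp.toLp 2 fun _ => (2 ^ k)⁻¹ / 2, ?_⟩
        rw [mem_interior_iff_mem_nhds]
        refine mem_of_superset (ball_mem_nhds _ (show (0 : ℝ) < (2 ^ k)⁻¹ / 2 by positivity)) ?_
        intro y hy i
        have h1 := (PiLp.norm_apply_le (y - (corner k (cell k x) +
          WithLp.toLp 2 fun _ => (2 ^ k)⁻¹ / 2)) i).trans_lt (mem_ball_iff_norm.1 hy)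
        simp only [PiLp.sub_apply, PiLp.add_apply, Real.norm_eq_abs, abs_lt] at h1
        constructor <;> linarith [h1.1, h1.2]
      · rw [hball _ _ (by positivity), hvol, hC, ← mul_assoc, mul_pow,
          ENNReal.ofReal_mul (by positivity)]
        calc _ = ENNReal.ofReal ((3 * √d) ^ d) * B * cubeVol d k := by
              rw [cubeVol, ENNReal.ofReal_pow (show (0 : ℝ) ≤ (2 ^ k)⁻¹ by positivity)]; ring
          _ ≤ _ := by gcongr; exact le_self_add
    · intro ε hε
      have h0 : Tendsto (fun k : ℕ => √d * ((2 : ℝ) ^ k)⁻¹) atTop (𝓝 (√d * 0)) :=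
        (_root_.tendsto_pow_atTop_atTop_of_one_lt
          (one_lt_two (α := ℝ))).inv_tendsto_atTop.const_mul _
      rw [mul_zero] at h0
      filter_upwards [h0.eventually_le_const hε] with k hk
      exact (hQball k x).trans (closedBall_subset_closedBall hk)
  refine (hx.comp hlim).congr fun k => ?_
  simp only [Function.comp, avg]
  rw [hvol, setLIntegral_congr (hQ k x)]

theorem tendsto_lintegral_avg_sub {d : ℕ} (g : EuclideanSpace ℝ (Fin d) → ℝ≥0∞) (hg : Measurable g)
    (hgi : ∫⁻ x, g x ≠ ⊤) : Tendsto (fun k => ∫⁻ x, (avg k g x - g x)) atTop (𝓝 0) := by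
  have h1 : ∀ k, ∫⁻ x, (avg k g x - g x) = ∫⁻ x, (g x - avg k g x) := by
    intro k
    have h2 : ∫⁻ x, g x + (avg k g x - g x) = ∫⁻ x, avg k g x + (g x - avg k g x) := by
      refine lintegral_congr fun x => ?_
      rcases le_total (g x) (avg k g x) with h | h
      · rw [add_tsub_cancel_of_le h, tsub_eq_zero_of_le h, add_zero]
      · rw [add_tsub_cancel_of_le h, tsub_eq_zero_of_le h, add_zero]
    rw [lintegral_add_left hg, lintegral_add_left (measurable_avg k g), lintegral_avg] at h2
    exact (ENNReal.add_right_inj hgi).1 h2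
  simp_rw [h1]
  rw [← lintegral_zero (α := EuclideanSpace ℝ (Fin d)) (μ := volume)]
  refine tendsto_lintegral_of_dominated_convergence g
    (fun k => hg.sub (measurable_avg k g)) (fun k => .of_forall fun x => tsub_le_self) hgi ?_
  filter_upwards [ae_tendsto_avg g hg hgi, ae_lt_top hg hgi] with x hx hxt
  have := ENNReal.Tendsto.sub (tendsto_const_nhds (x := g x)) hx (Or.inl hxt.ne)
  simpa using this

theorem lintegral_le_of_tendsto_ae {X : Type*} [MeasurableSpace X] {ν : Measure X}
    {F : ℕ → X → ℝ≥0∞} {G : X → ℝ≥0∞} {R : ℕ → ℝ≥0∞} {L : ℝ≥0∞} (hF : ∀ k, Measurable (F k))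
    (hFG : ∀ᵐ x ∂ν, Tendsto (fun k => F k x) atTop (𝓝 (G x)))
    (hR : Tendsto R atTop (𝓝 L)) (h : ∀ᶠ k in atTop, ∫⁻ x, F k x ∂ν ≤ R k) :
    ∫⁻ x, G x ∂ν ≤ L := by
  calc ∫⁻ x, G x ∂ν = ∫⁻ x, liminf (fun k => F k x) atTop ∂ν :=
        lintegral_congr_ae (hFG.mono fun x hx => hx.liminf_eq.symm)
    _ ≤ liminf (fun k => ∫⁻ x, F k x ∂ν) atTop := lintegral_liminf_le hF
    _ ≤ liminf R atTop := liminf_le_liminf h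
    _ = L := hR.liminf_eq

theorem ennreal_young {t lam : ℝ} (ht : 0 < t) (hlam : 0 < lam) (c : ℝ≥0∞) {b : ℝ≥0∞} (hb0 : b ≠ 0)
    (hbt : b ≠ ⊤) :
    ENNReal.ofReal (1 + t) * ENNReal.ofReal lam ^ t * c ^ (1 / (1 + t)) ≤
      c * b ^ (-t) + ENNReal.ofReal t * ENNReal.ofReal lam ^ (1 + t) * b := by
  rcases eq_or_ne c ⊤ with rfl | hc
  · have h0 : b ^ (-t) ≠ 0 := by
      rw [ENNReal.rpow_neg]
      exact ENNReal.inv_ne_zero.2 (ENNReal.rpow_ne_top_of_nonneg ht.le hbt)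
    rw [ENNReal.top_mul h0, top_add]
    exact le_top
  · lift c to NNReal using hc
    lift b to NNReal using hbt
    have hb : (0 : ℝ) < b := by
      rw [NNReal.coe_pos, pos_iff_ne_zero]
      exact_mod_cast hb0
    rw [← ENNReal.ofReal_coe_nnreal, ← ENNReal.ofReal_coe_nnreal,
      ENNReal.ofReal_rpow_of_pos hlam, ENNReal.ofReal_rpow_of_pos hlam,
      ENNReal.ofReal_rpow_of_nonneg c.coe_nonneg (by positivity), ENNReal.ofReal_rpow_of_pos hb,
      ← ENNReal.ofReal_mul (by positivity), ← ENNReal.ofReal_mul (by positivity),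
      ← ENNReal.ofReal_mul c.coe_nonneg, ← ENNReal.ofReal_mul (by positivity),
      ← ENNReal.ofReal_mul (by positivity), ← ENNReal.ofReal_add (by positivity) (by positivity)]
    refine ENNReal.ofReal_le_ofReal ?_
    have h := Real.geom_mean_le_arith_mean2_weighted (w₁ := 1 / (1 + t)) (w₂ := t / (1 + t))
      (p₁ := c * (b : ℝ) ^ (-t)) (p₂ := lam ^ (1 + t) * b) (by positivity) (by positivity)
      (by positivity) (by positivity) (by field_simp)
    rw [Real.mul_rpow (by positivity) (by positivity), Real.mul_rpow (by positivity) (by positivity),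
      ← Real.rpow_mul hb.le, ← Real.rpow_mul hlam.le] at h
    have e1 : (1 + t) * (t / (1 + t)) = t := by field_simp
    have e2 : (c : ℝ) ^ (1 / (1 + t)) * (b : ℝ) ^ (-t * (1 / (1 + t))) *
        (lam ^ t * (b : ℝ) ^ (t / (1 + t))) = (c : ℝ) ^ (1 / (1 + t)) * lam ^ t := by
      calc _ = (c : ℝ) ^ (1 / (1 + t)) * lam ^ t *
            ((b : ℝ) ^ (-t * (1 / (1 + t))) * (b : ℝ) ^ (t / (1 + t))) := by ring
        _ = _ := by
          rw [← Real.rpow_add hb]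
          have : -t * (1 / (1 + t)) + t / (1 + t) = 0 := by ring
          rw [this, Real.rpow_zero, mul_one]
    rw [e1, e2] at h
    have h' := mul_le_mul_of_nonneg_left h (show 0 ≤ 1 + t by positivity)
    calc _ = (1 + t) * ((c : ℝ) ^ (1 / (1 + t)) * lam ^ t) := by ring
      _ ≤ _ := by
        refine h'.trans (le_of_eq ?_)
        field_simp

/-- The limiting density of code points, along an ultrafilter, in the dyadic cube of generation `k`
containing `x`. -/
def cubeDens {d : ℕ} (U : Ultrafilter ℕ) (α : ℕ → Finset (EuclideanSpace ℝ (Fin d))) (k : ℕ)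
    (x : EuclideanSpace ℝ (Fin d)) : ℝ≥0∞ :=
  dens U α (cube k (cell k x)) / cubeVol d k

theorem measurable_cubeDens {d : ℕ} (U : Ultrafilter ℕ)
    (α : ℕ → Finset (EuclideanSpace ℝ (Fin d))) (k : ℕ) : Measurable (cubeDens U α k) :=
  (measurable_of_countable fun z : Fin d → ℤ => dens U α (cube k z) / cubeVol d k).comp
    (measurable_cell k)

theorem cubeDens_ne_top {d : ℕ} {U : Ultrafilter ℕ} (hU : (U : Filter ℕ) ≤ atTop)
    {α : ℕ → Finset (EuclideanSpace ℝ (Fin d))} (hα : ∀ n, 1 ≤ n → (α n).Nonempty ∧ (α n).card ≤ n)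
    (k : ℕ) (x : EuclideanSpace ℝ (Fin d)) : cubeDens U α k x ≠ ⊤ :=
  ENNReal.div_ne_top (ne_top_of_le_ne_top ENNReal.one_ne_top (dens_le_one hU hα _))
    (cubeVol_ne_zero d k)

theorem setLIntegral_cubeDens_le {d : ℕ} (U : Ultrafilter ℕ)
    (α : ℕ → Finset (EuclideanSpace ℝ (Fin d))) {k₀ k : ℕ} (hk : k₀ ≤ k) (z₀ : Fin d → ℤ) :
    ∫⁻ x in cube k₀ z₀, cubeDens U α k x ≤ dens U α (cube k₀ z₀) := by
  let A : (Fin d → ℤ) → Set (EuclideanSpace ℝ (Fin d)) := fun z => cube k z ∩ cube k₀ z₀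
  have hmono : ∀ z, A z ⊆ cube k₀ z₀ := fun z => inter_subset_right
  have hdisj : Pairwise (Function.onFun Disjoint A) := fun z w hzw =>
    (pairwise_disjoint_cube k hzw).mono inter_subset_left inter_subset_left
  rw [← lintegral_indicator (measurableSet_cube _ _), ← tsum_setLIntegral_cube k]
  refine le_trans (ENNReal.tsum_le_tsum fun z => ?_) (tsum_dens_le U α A _ hdisj hmono)
  by_cases hz : (A z).Nonempty
  · obtain ⟨y, hy, hy₀⟩ := hz
    have hsub : cube k z ⊆ cube k₀ z₀ := fun x hx => by
      rw [mem_cube_iff] at *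
      rw [← hy₀]
      exact cell_eq_of_le hk (hx.trans hy.symm)
    have hA : A z = cube k z := inter_eq_left.2 hsub
    rw [hA, setLIntegral_congr_fun (g := fun _ => dens U α (cube k z) / cubeVol d k)
      (measurableSet_cube k z), setLIntegral_const, volume_cube,
      ENNReal.div_mul_cancel (cubeVol_ne_zero d k) (cubeVol_ne_top d k)]
    intro x hx
    simp only [indicator_of_mem (hsub hx), cubeDens, mem_cube_iff.1 hx]
  · rw [Set.not_nonempty_iff_eq_empty] at hz
    rw [setLIntegral_congr_fun (g := fun _ => 0) (measurableSet_cube k z)]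
    · simp
    · intro x hx
      exact indicator_of_notMem (fun hx₀ => (hz ▸ ⟨hx, hx₀⟩ : x ∈ (∅ : Set _))) _

theorem lintegral_avg_mul_cubeDens_le {d : ℕ} (hd : 1 ≤ d) {s : ℝ} (hs : 0 < s)
    {U : Ultrafilter ℕ} (hU : (U : Filter ℕ) ≤ atTop)
    {α : ℕ → Finset (EuclideanSpace ℝ (Fin d))} (hα : ∀ n, 1 ≤ n → (α n).Nonempty ∧ (α n).card ≤ n)
    {ε : ℝ} (hε : 0 < ε) (g : EuclideanSpace ℝ (Fin d) → ℝ≥0∞) (hg : Measurable g)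
    (hgi : ∫⁻ x, g x ≠ ⊤) (k : ℕ) :
    Jrd s d * ∫⁻ x, avg k g x * (cubeDens U α k x + ENNReal.ofReal ε) ^ (-(s / d)) ≤
      locErr U α s g univ + ENNReal.ofReal (2 * √d) ^ s * ENNReal.ofReal ε ^ (-(s / d)) *
        ∫⁻ x, (avg k g x - g x) := by
  unfold avg cubeDens
  rw [lintegral_comp_cell k fun z => (∫⁻ y in cube k z, g y) / cubeVol d k *
    (dens U α (cube k z) / cubeVol d k + ENNReal.ofReal ε) ^ (-(s / d)), ← ENNReal.tsum_mul_left,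
    ← tsum_setLIntegral_cube k fun x => (∫⁻ y in cube k (cell k x), g y) / cubeVol d k - g x,
    ← ENNReal.tsum_mul_left]
  refine le_trans ?_ (add_le_add (tsum_locErr_le U α s g (cube k) (measurableSet_cube k)
    (pairwise_disjoint_cube k) univ fun z => subset_univ _) le_rfl)
  rw [← ENNReal.tsum_add]
  refine ENNReal.tsum_le_tsum fun z => ?_
  rw [setLIntegral_congr_fun (f := fun x => (∫⁻ y in cube k (cell k x), g y) / cubeVol d k - g x)
    (g := fun x => (∫⁻ y in cube k z, g y) / cubeVol d k - g x) (measurableSet_cube k z)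
    fun x hx => by simp only [mem_cube_iff.1 hx]]
  exact box_locErr_lower_bound hd hs hU hα (corner k z) (by positivity) hε (ENNReal.div_ne_top
    (ne_top_of_le_ne_top hgi (setLIntegral_le_lintegral _ _)) (cubeVol_ne_zero d k)) g hg

theorem locErr_indicator {d : ℕ} (U : Ultrafilter ℕ) (α : ℕ → Finset (EuclideanSpace ℝ (Fin d)))
    (s : ℝ) (g : EuclideanSpace ℝ (Fin d) → ℝ≥0∞) {A : Set (EuclideanSpace ℝ (Fin d))}
    (hA : MeasurableSet A) : locErr U α s (A.indicator g) univ = locErr U α s g A := by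
  unfold locErr
  congr 1
  funext n
  rw [setLIntegral_univ, ← lintegral_indicator hA]
  congr 1
  refine lintegral_congr fun x => ?_
  rw [Set.indicator_mul_left]

theorem tendsto_penalty {d : ℕ} {s : ℝ} (hs : 0 < s) {ε : ℝ} (hε : 0 < ε)
    (g : EuclideanSpace ℝ (Fin d) → ℝ≥0∞) (hg : Measurable g) (hgi : ∫⁻ x, g x ≠ ⊤) :
    Tendsto (fun k => ENNReal.ofReal (2 * √d) ^ s * ENNReal.ofReal ε ^ (-(s / d)) *
        ∫⁻ x, (avg k g x - g x)) atTop (𝓝 0) := by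
  rw [← mul_zero (ENNReal.ofReal (2 * √d) ^ s * ENNReal.ofReal ε ^ (-(s / d)))]
  refine ENNReal.Tendsto.const_mul (tendsto_lintegral_avg_sub g hg hgi) (Or.inr ?_)
  exact ENNReal.mul_ne_top (ENNReal.rpow_ne_top_of_nonneg hs.le (by finiteness))
    (ENNReal.rpow_ne_top_of_ne_zero (by simpa using hε) (by finiteness))

theorem cube_tradeoff {d : ℕ} (hd : 1 ≤ d) {r : ℝ} (hr : 0 < r)
    {U : Ultrafilter ℕ} (hU : (U : Filter ℕ) ≤ atTop)
    {α : ℕ → Finset (EuclideanSpace ℝ (Fin d))} (hα : ∀ n, 1 ≤ n → (α n).Nonempty ∧ (α n).card ≤ n)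
    (F : EuclideanSpace ℝ (Fin d) → ℝ≥0∞) (hF : Measurable F)
    (hFi : ∫⁻ x, F x ≠ ⊤) (k₀ : ℕ) (z₀ : Fin d → ℤ) {lam : ℝ} (hlam : 0 < lam) :
    Jrd r d * (ENNReal.ofReal (1 + r / d) * ENNReal.ofReal lam ^ (r / d) *
        ∫⁻ x in cube k₀ z₀, F x ^ (1 / (1 + r / d))) ≤
      locErr U α r F (cube k₀ z₀) +
        Jrd r d * (ENNReal.ofReal (r / d) * ENNReal.ofReal lam ^ (1 + r / d) *
          dens U α (cube k₀ z₀)) := by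
  have hd0 : (0 : ℝ) < d := by exact_mod_cast hd
  have ht : 0 < r / d := by positivity
  have hJ : Jrd r d ≠ ⊤ := Jrd_ne_top hr
  set t := r / d with htdef
  set Q := cube k₀ z₀ with hQ
  have hQm : MeasurableSet Q := measurableSet_cube _ _
  set C₁ := ENNReal.ofReal (1 + t) * ENNReal.ofReal lam ^ t with hC₁
  set C₂ := ENNReal.ofReal t * ENNReal.ofReal lam ^ (1 + t) with hC₂
  have hC₁t : C₁ ≠ ⊤ :=
    ENNReal.mul_ne_top (by finiteness) (ENNReal.rpow_ne_top_of_nonneg ht.le (by finiteness))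
  have hC₂t : C₂ ≠ ⊤ := ENNReal.mul_ne_top (by finiteness)
    (ENNReal.rpow_ne_top_of_nonneg (by positivity) (by finiteness))
  set G := Q.indicator F with hG
  have hGm : Measurable G := hF.indicator hQm
  have hGi : ∫⁻ x, G x ≠ ⊤ := by
    rw [hG, lintegral_indicator hQm]
    exact ne_top_of_le_ne_top hFi (setLIntegral_le_lintegral _ _)
  have main : ∀ ε : ℝ, 0 < ε → Jrd r d * (C₁ * ∫⁻ x in Q, F x ^ (1 / (1 + t))) ≤
      locErr U α r F Q +
        Jrd r d * (C₂ * (dens U α Q + ENNReal.ofReal ε * cubeVol d k₀)) := by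
    intro ε hε
    have hm : Measurable fun x => F x ^ (1 / (1 + t)) := hF.pow_const _
    rw [← lintegral_const_mul _ hm, ← lintegral_const_mul _ (hm.const_mul _)]
    have hlim : Tendsto (fun k => locErr U α r F Q +
        ENNReal.ofReal (2 * √d) ^ r * ENNReal.ofReal ε ^ (-(r / d)) * (∫⁻ x, (avg k G x - G x)) +
        Jrd r d * (C₂ * (dens U α Q + ENNReal.ofReal ε * cubeVol d k₀))) atTop
        (𝓝 (locErr U α r F Q + 0 +
          Jrd r d * (C₂ * (dens U α Q + ENNReal.ofReal ε * cubeVol d k₀)))) :=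
      (tendsto_const_nhds.add (tendsto_penalty hr hε G hGm hGi)).add tendsto_const_nhds
    rw [add_zero] at hlim
    refine lintegral_le_of_tendsto_ae
      (F := fun k x => Jrd r d * (C₁ * avg k G x ^ (1 / (1 + t)))) (fun k => ?_) ?_ hlim ?_
    · exact (((measurable_avg k G).pow_const _).const_mul _).const_mul _
    · filter_upwards [ae_restrict_of_ae (ae_tendsto_avg G hGm hGi), ae_restrict_mem hQm] with x hx hxQ
      have hxG : G x = F x := indicator_of_mem hxQ F
      rw [hxG] at hx
      exact ENNReal.Tendsto.const_mul
        (ENNReal.Tendsto.const_mul (hx.ennrpow_const _) (Or.inr hC₁t)) (Or.inr hJ)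
    · filter_upwards [eventually_ge_atTop k₀] with k hk
      have hb : Measurable fun x => cubeDens U α k x + ENNReal.ofReal ε :=
        (measurable_cubeDens U α k).add_const _
      have hcb : Measurable fun x => avg k G x * (cubeDens U α k x + ENNReal.ofReal ε) ^ (-t) :=
        (measurable_avg k G).mul (hb.pow_const _)
      calc ∫⁻ x in Q, Jrd r d * (C₁ * avg k G x ^ (1 / (1 + t)))
          ≤ ∫⁻ x in Q, (Jrd r d * (avg k G x * (cubeDens U α k x + ENNReal.ofReal ε) ^ (-t)) +
              Jrd r d * (C₂ * (cubeDens U α k x + ENNReal.ofReal ε))) := by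
            refine lintegral_mono fun x => ?_
            rw [← mul_add]
            gcongr
            refine ennreal_young ht hlam _ ?_ ?_
            · have : ENNReal.ofReal ε ≠ 0 := by simpa using hε
              simp [this]
            · have := cubeDens_ne_top hU hα k x
              finiteness
        _ = Jrd r d * (∫⁻ x in Q, avg k G x * (cubeDens U α k x + ENNReal.ofReal ε) ^ (-t)) +
              Jrd r d * (C₂ * ((∫⁻ x in Q, cubeDens U α k x) +
                ENNReal.ofReal ε * cubeVol d k₀)) := by
            rw [lintegral_add_right _ ((hb.const_mul _).const_mul _),
              lintegral_const_mul _ hcb, lintegral_const_mul _ (hb.const_mul _), lintegral_const_mul _ hb,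
              lintegral_add_right _ measurable_const, setLIntegral_const, hQ, volume_cube]
        _ ≤ _ := by
            refine add_le_add ?_ ?_
            · refine le_trans ?_ ((lintegral_avg_mul_cubeDens_le hd hr hU hα hε G hGm hGi k).trans
                (le_of_eq ?_))
              · gcongr
                exact Measure.restrict_le_self
              · rw [hG, locErr_indicator U α r F hQm]
            · gcongr
              exact setLIntegral_cubeDens_le U α hk z₀
  have hlim : Tendsto (fun ε : ℝ => locErr U α r F Q +
      Jrd r d * (C₂ * (dens U α Q + ENNReal.ofReal ε * cubeVol d k₀))) (𝓝[>] 0)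
      (𝓝 (locErr U α r F Q +
        Jrd r d * (C₂ * (dens U α Q + ENNReal.ofReal 0 * cubeVol d k₀)))) := by
    refine tendsto_const_nhds.add (ENNReal.Tendsto.const_mul
      (ENNReal.Tendsto.const_mul (tendsto_const_nhds.add ?_) (Or.inr hC₂t)) (Or.inr hJ))
    refine ENNReal.Tendsto.mul_const ?_ (Or.inr (cubeVol_ne_top d k₀))
    exact (ENNReal.continuous_ofReal.tendsto 0).mono_left nhdsWithin_le_nhds
  rw [ENNReal.ofReal_zero, zero_mul, add_zero] at hlim
  exact ge_of_tendsto hlim (by filter_upwards [self_mem_nhdsWithin] with ε hε using main ε hε)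

theorem mul_eq_of_forall_rpow_le {t Z v W : ℝ} (ht : 0 < t) (hZ : 0 < Z)
    (h : ∀ lam : ℝ, 0 < lam →
      (1 + t) * (lam ^ t - Z ^ t) * W ≤ t * (lam ^ (1 + t) - Z ^ (1 + t)) * v) :
    v * Z = W := by
  let φ : ℝ → ℝ := fun lam =>
    t * (lam ^ (1 + t) - Z ^ (1 + t)) * v - (1 + t) * (lam ^ t - Z ^ t) * W
  have hφ : IsLocalMin φ Z := by
    filter_upwards [Ioi_mem_nhds hZ] with lam hlam
    simp only [φ, sub_self, mul_zero, zero_mul]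
    linarith [h lam hlam]
  have hder : HasDerivAt φ (t * ((1 + t) * Z ^ (1 + t - 1)) * v - (1 + t) * (t * Z ^ (t - 1)) * W)
      Z := by
    refine ((((Real.hasDerivAt_rpow_const (Or.inl hZ.ne')).sub_const _).const_mul t).mul_const v).sub
      ((((Real.hasDerivAt_rpow_const (Or.inl hZ.ne')).sub_const _).const_mul (1 + t)).mul_const W)
  have h0 := hφ.hasDerivAt_eq_zero hder
  have hpow : Z ^ (1 + t - 1) = Z ^ (t - 1) * Z := by
    rw [← Real.rpow_add_one hZ.ne']
    congr 1
    ring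
  rw [hpow] at h0
  have hne : t * (1 + t) * Z ^ (t - 1) ≠ 0 := by positivity
  have h1 : t * (1 + t) * Z ^ (t - 1) * (v * Z - W) = 0 := by linarith
  rcases mul_eq_zero.1 h1 with h2 | h2
  · exact absurd h2 hne
  · linarith

theorem dens_cube_mul_eq {d : ℕ} (hd : 1 ≤ d) {r : ℝ} (hr : 0 < r)
    {U : Ultrafilter ℕ} (hU : (U : Filter ℕ) ≤ atTop)
    {α : ℕ → Finset (EuclideanSpace ℝ (Fin d))} (hα : ∀ n, 1 ≤ n → (α n).Nonempty ∧ (α n).card ≤ n)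
    (F : EuclideanSpace ℝ (Fin d) → ℝ≥0∞) (hF : Measurable F)
    (hFi : ∫⁻ x, F x ≠ ⊤) (hZ0 : ∫⁻ x, F x ^ (1 / (1 + r / d)) ≠ 0)
    (hZt : ∫⁻ x, F x ^ (1 / (1 + r / d)) ≠ ⊤)
    (hopt : locErr U α r F univ ≤
      Jrd r d * (∫⁻ x, F x ^ (1 / (1 + r / d))) ^ (1 + r / d)) (k : ℕ) (z : Fin d → ℤ) :
    dens U α (cube k z) * ∫⁻ x, F x ^ (1 / (1 + r / d)) =
      ∫⁻ x in cube k z, F x ^ (1 / (1 + r / d)) := by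
  have hd0 : (0 : ℝ) < d := by exact_mod_cast hd
  have ht : 0 < r / d := by positivity
  have hJt : Jrd r d ≠ ⊤ := Jrd_ne_top hr
  have hJ0 : Jrd r d ≠ 0 := Jrd_ne_zero hd hr
  have hstar := fun z (lam : ℝ) (hlam : 0 < lam) =>
    cube_tradeoff hd hr hU hα F hF hFi k z hlam
  have hvt : ∀ z, dens U α (cube k z) ≠ ⊤ := fun z =>
    ne_top_of_le_ne_top ENNReal.one_ne_top (dens_le_one hU hα _)
  have hv1 : ∑' z, dens U α (cube k z) ≤ 1 :=
    (tsum_dens_le U α (cube k) univ (pairwise_disjoint_cube k) fun _ => subset_univ _).trans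
      (dens_le_one hU hα _)
  have he := (tsum_locErr_le U α r F (cube k) (measurableSet_cube k)
    (pairwise_disjoint_cube k) univ fun _ => subset_univ _).trans hopt
  have hW := tsum_setLIntegral_cube k fun x => F x ^ (1 / (1 + r / d))
  have hWt : ∀ z, ∫⁻ x in cube k z, F x ^ (1 / (1 + r / d)) ≠ ⊤ := fun z =>
    ne_top_of_le_ne_top hZt (setLIntegral_le_lintegral _ _)
  set t := r / d with htdef
  set Z := ∫⁻ x, F x ^ (1 / (1 + t)) with hZ
  set W : (Fin d → ℤ) → ℝ≥0∞ := fun z => ∫⁻ x in cube k z, F x ^ (1 / (1 + t)) with hWdef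
  set v : (Fin d → ℤ) → ℝ≥0∞ := fun z => dens U α (cube k z) with hvdef
  set e : (Fin d → ℤ) → ℝ≥0∞ := fun z => locErr U α r F (cube k z) with hedef
  have hZr : 0 < Z.toReal := ENNReal.toReal_pos hZ0 hZt
  have hZof : ENNReal.ofReal Z.toReal = Z := ENNReal.ofReal_toReal hZt
  have het : e z ≠ ⊤ := by
    refine ne_top_of_le_ne_top ?_ ((ENNReal.le_tsum z).trans he)
    exact ENNReal.mul_ne_top hJt (ENNReal.rpow_ne_top_of_nonneg (by positivity) hZt)
  have hpow : Z ^ (1 + t) = Z ^ t * Z := by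
    rw [add_comm, ENNReal.rpow_add _ _ hZ0 hZt, ENNReal.rpow_one]
  have hZpt : Z ^ (1 + t) ≠ ⊤ := ENNReal.rpow_ne_top_of_nonneg (by positivity) hZt
  have hZtt : Z ^ t ≠ ⊤ := ENNReal.rpow_ne_top_of_nonneg (by positivity) hZt
  have heq : Jrd r d * (ENNReal.ofReal (1 + t) * Z ^ t * W z) =
      e z + Jrd r d * (ENNReal.ofReal t * Z ^ (1 + t) * v z) := by
    by_contra hne
    have hle : ∀ z, Jrd r d * (ENNReal.ofReal (1 + t) * Z ^ t * W z) ≤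
        e z + Jrd r d * (ENNReal.ofReal t * Z ^ (1 + t) * v z) := by
      intro z
      have := hstar z Z.toReal hZr
      rwa [hZof] at this
    have hsum : ∑' z, Jrd r d * (ENNReal.ofReal (1 + t) * Z ^ t * W z) =
        Jrd r d * (ENNReal.ofReal (1 + t) * Z ^ (1 + t)) := by
      rw [ENNReal.tsum_mul_left, ENNReal.tsum_mul_left, hW, hpow, mul_assoc]
    have hlt := ENNReal.tsum_lt_tsum (by rw [hsum]; finiteness) hle (lt_of_le_of_ne (hle z) hne)
    rw [hsum, ENNReal.tsum_add, ENNReal.tsum_mul_left, ENNReal.tsum_mul_left] at hlt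
    refine absurd hlt (not_lt.2 ?_)
    calc _ ≤ Jrd r d * Z ^ (1 + t) + Jrd r d * (ENNReal.ofReal t * Z ^ (1 + t) * 1) := by gcongr
      _ = _ := by
        rw [ENNReal.ofReal_add zero_le_one ht.le, ENNReal.ofReal_one]
        ring
  have hreal : ∀ lam : ℝ, 0 < lam → (Jrd r d).toReal * ((1 + t) * lam ^ t * (W z).toReal) ≤
      (e z).toReal + (Jrd r d).toReal * (t * lam ^ (1 + t) * (v z).toReal) := by
    intro lam hlam
    have h := hstar z lam hlam
    have hp1 : ENNReal.ofReal lam ^ t = ENNReal.ofReal (lam ^ t) := ENNReal.ofReal_rpow_of_pos hlam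
    have hp2 : ENNReal.ofReal lam ^ (1 + t) = ENNReal.ofReal (lam ^ (1 + t)) :=
      ENNReal.ofReal_rpow_of_pos hlam
    rw [hp1, hp2] at h
    have hfin : Jrd r d * (ENNReal.ofReal t * ENNReal.ofReal (lam ^ (1 + t)) * v z) ≠ ⊤ := by
      have := hvt z
      finiteness
    have h' := ENNReal.toReal_mono (ENNReal.add_ne_top.2 ⟨het, hfin⟩) h
    rw [ENNReal.toReal_add het hfin] at h'
    simp only [ENNReal.toReal_mul] at h'
    rwa [ENNReal.toReal_ofReal (by positivity), ENNReal.toReal_ofReal (by positivity),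
      ENNReal.toReal_ofReal (by positivity), ENNReal.toReal_ofReal (by positivity)] at h'
  have hreal' : (Jrd r d).toReal * ((1 + t) * Z.toReal ^ t * (W z).toReal) =
      (e z).toReal + (Jrd r d).toReal * (t * Z.toReal ^ (1 + t) * (v z).toReal) := by
    have h := congrArg ENNReal.toReal heq
    have hfin : Jrd r d * (ENNReal.ofReal t * Z ^ (1 + t) * v z) ≠ ⊤ := by
      have := hvt z
      finiteness
    rw [ENNReal.toReal_add het hfin] at h
    simp only [ENNReal.toReal_mul, ← ENNReal.toReal_rpow] at h
    rwa [ENNReal.toReal_ofReal (by positivity), ENNReal.toReal_ofReal (by positivity)] at h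
  have hJr : 0 < (Jrd r d).toReal := ENNReal.toReal_pos hJ0 hJt
  have hfinal := mul_eq_of_forall_rpow_le (v := (v z).toReal) (W := (W z).toReal) ht hZr
    fun lam hlam => by
      have h1 := hreal lam hlam
      refine le_of_mul_le_mul_left ?_ hJr
      linarith
  rw [← ENNReal.toReal_mul] at hfinal
  exact (ENNReal.toReal_eq_toReal_iff' (ENNReal.mul_ne_top (hvt z) hZt) (hWt z)).1 hfinal

theorem one_add_rpow_le {p : ℝ} (hp : 0 ≤ p) (y : ℝ≥0∞) : (1 + y) ^ p ≤ 2 ^ p * (1 + y ^ p) := by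
  calc (1 + y) ^ p ≤ (2 * max 1 y) ^ p := by
        gcongr
        rw [two_mul]
        exact add_le_add (le_max_left _ _) (le_max_right _ _)
    _ = 2 ^ p * max 1 y ^ p := ENNReal.mul_rpow_of_nonneg _ _ hp
    _ ≤ 2 ^ p * (1 + y ^ p) := by
        gcongr
        rcases le_total 1 y with h | h
        · rw [max_eq_right h]; exact le_add_self
        · rw [max_eq_left h, ENNReal.one_rpow]; exact le_self_add

theorem lintegral_mul_le_of_withDensity_le {X : Type*} [MeasurableSpace X] {ν P : Measure X}
    {F h : X → ℝ≥0∞} (hF : Measurable F) (hh : Measurable h) (hP : ν.withDensity F ≤ P) :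
    ∫⁻ x, F x * h x ∂ν ≤ ∫⁻ x, h x ∂P := by
  calc ∫⁻ x, F x * h x ∂ν = ∫⁻ x, h x ∂(ν.withDensity F) :=
        (lintegral_withDensity_eq_lintegral_mul _ hF hh).symm
    _ ≤ ∫⁻ x, h x ∂P := lintegral_mono' hP le_rfl

theorem lintegral_rpow_ne_top_of_moment {d : ℕ} (hd : 1 ≤ d) {r η : ℝ} (hr : 0 < r) (hη : 0 < η)
    {P : Measure (EuclideanSpace ℝ (Fin d))} [IsFiniteMeasure P]
    {F : EuclideanSpace ℝ (Fin d) → ℝ≥0∞} (hF : Measurable F)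
    (hP : volume.withDensity F ≤ P) (hmom : (∫⁻ x, ENNReal.ofReal ‖x‖ ^ (r + η) ∂P) ≠ ⊤) :
    ∫⁻ x, F x ^ (1 / (1 + r / d)) ≠ ⊤ := by
  have hd0 : (0 : ℝ) < d := by exact_mod_cast hd
  have ht : 0 < r / d := by positivity
  set t := r / d with htdef
  have hw : ∫⁻ x, ENNReal.ofReal (1 + ‖x‖) ^ (r + η) ∂P ≠ ⊤ := by
    refine ne_top_of_le_ne_top (b := ∫⁻ x, 2 ^ (r + η) * (1 + ENNReal.ofReal ‖x‖ ^ (r + η)) ∂P) ?_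
      (lintegral_mono fun x => ?_)
    · rw [lintegral_const_mul _ (by fun_prop), lintegral_add_left measurable_const]
      refine ENNReal.mul_ne_top (ENNReal.rpow_ne_top_of_nonneg (by positivity) (by finiteness)) ?_
      refine ENNReal.add_ne_top.2 ⟨?_, hmom⟩
      rw [lintegral_one]
      exact measure_ne_top _ _
    · rw [ENNReal.ofReal_add zero_le_one (norm_nonneg x), ENNReal.ofReal_one]
      exact one_add_rpow_le (by positivity) _
  have hb : ∫⁻ x : EuclideanSpace ℝ (Fin d), ENNReal.ofReal ((1 + ‖x‖) ^ (-((r + η) / t))) ≠ ⊤ := by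
    refine (finite_integral_one_add_norm ?_).ne
    have hdt : d * t = r := by rw [htdef]; field_simp
    rw [finrank_euclideanSpace, Fintype.card_fin, lt_div_iff₀ ht, hdt]
    linarith
  have hpt : ∀ x, F x ^ (1 / (1 + t)) ≤ F x * ENNReal.ofReal (1 + ‖x‖) ^ (r + η) +
      ENNReal.ofReal t * ENNReal.ofReal ((1 + ‖x‖) ^ (-((r + η) / t))) := by
    intro x
    have hx : 0 < 1 + ‖x‖ := by positivity
    have h := ennreal_young ht one_pos (F x)
      (b := ENNReal.ofReal ((1 + ‖x‖) ^ (-((r + η) / t))))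
      (by rw [Ne, ENNReal.ofReal_eq_zero, not_le]; positivity) (by finiteness)
    rw [ENNReal.ofReal_one, ENNReal.one_rpow, ENNReal.one_rpow, mul_one, mul_one,
      ENNReal.ofReal_rpow_of_pos (x := (1 + ‖x‖) ^ (-((r + η) / t))) (by positivity),
      ← Real.rpow_mul hx.le] at h
    have hexp : -((r + η) / t) * -t = r + η := by field_simp
    rw [hexp, ← ENNReal.ofReal_rpow_of_pos hx] at h
    refine le_trans ?_ h
    refine le_mul_of_one_le_left' ?_
    rw [← ENNReal.ofReal_one]
    exact ENNReal.ofReal_le_ofReal (by linarith)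
  refine ne_top_of_le_ne_top ?_ (lintegral_mono hpt)
  have hm : Measurable fun x => F x * ENNReal.ofReal (1 + ‖x‖) ^ (r + η) := hF.mul (by fun_prop)
  rw [lintegral_add_left hm, lintegral_const_mul _ (by fun_prop)]
  exact ENNReal.add_ne_top.2 ⟨ne_top_of_le_ne_top hw
    (lintegral_mul_le_of_withDensity_le hF (by fun_prop) hP),
    ENNReal.mul_ne_top (by finiteness) hb⟩

theorem Jrd_mul_lintegral_le_locErr {d : ℕ} (hd : 1 ≤ d) {s : ℝ} (hs : 0 < s)
    {U : Ultrafilter ℕ} (hU : (U : Filter ℕ) ≤ atTop)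
    {α : ℕ → Finset (EuclideanSpace ℝ (Fin d))} (hα : ∀ n, 1 ≤ n → (α n).Nonempty ∧ (α n).card ≤ n)
    {W g : EuclideanSpace ℝ (Fin d) → ℝ≥0∞} (hW : Measurable W) (hg : Measurable g)
    (hgi : ∫⁻ x, g x ≠ ⊤) (hZ0 : ∫⁻ x, W x ≠ 0) (hZt : ∫⁻ x, W x ≠ ⊤)
    (hdens : ∀ k z, dens U α (cube k z) * ∫⁻ x, W x = ∫⁻ x in cube k z, W x) :
    Jrd s d * ∫⁻ x in {x | W x ≠ 0}, g x * (W x / ∫⁻ x, W x) ^ (-(s / d)) ≤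
      locErr U α s g univ := by
  have hd0 : (0 : ℝ) < d := by exact_mod_cast hd
  have hp : 0 < s / d := by positivity
  have hJ : Jrd s d ≠ ⊤ := Jrd_ne_top hs
  set Z := ∫⁻ x, W x with hZ
  set p := s / d with hpdef
  have hcd : ∀ k x, cubeDens U α k x = avg k W x / Z := by
    intro k x
    unfold cubeDens avg
    rw [← hdens, div_eq_mul_inv, div_eq_mul_inv, div_eq_mul_inv, mul_right_comm, mul_assoc _ Z,
      ENNReal.mul_inv_cancel hZ0 hZt, mul_one]
  have hbt : ∀ (y : ℝ≥0∞), y ≠ 0 → y ^ (-p) ≠ ⊤ := by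
    intro y hy
    rw [ENNReal.rpow_neg]
    refine ENNReal.inv_ne_top.2 fun h0 => ?_
    rcases ENNReal.rpow_eq_zero_iff.1 h0 with h | h
    · exact hy h.1
    · exact absurd h.2 (not_lt.2 hp.le)
  have hgae := ae_lt_top hg hgi
  have hmeas : ∀ c : ℝ≥0∞, Measurable fun x => g x * (W x / Z + c) ^ (-p) := fun c =>
    hg.mul (((hW.div_const _).add_const _).pow_const _)
  have main : ∀ ε : ℝ, 0 < ε →
      ∫⁻ x, Jrd s d * (g x * (W x / Z + ENNReal.ofReal ε) ^ (-p)) ≤ locErr U α s g univ := by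
    intro ε hε
    have hε0 : ENNReal.ofReal ε ≠ 0 := by simpa using hε
    have hlim := tendsto_const_nhds (x := locErr U α s g univ) |>.add
      (tendsto_penalty hs hε g hg hgi)
    rw [add_zero] at hlim
    have hFk : ∀ k, Measurable fun x =>
        avg k g x * (cubeDens U α k x + ENNReal.ofReal ε) ^ (-p) := fun k =>
      (measurable_avg k g).mul (((measurable_cubeDens U α k).add_const _).pow_const _)
    refine lintegral_le_of_tendsto_ae (fun k => (hFk k).const_mul (Jrd s d)) ?_ hlim
      (.of_forall fun k => ?_)
    · filter_upwards [ae_tendsto_avg g hg hgi, ae_tendsto_avg W hW hZt, hgae] with x hx hWx hgx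
      refine ENNReal.Tendsto.const_mul (ENNReal.Tendsto.mul hx (Or.inr (hbt _ (by simp [hε0]))) ?_
        (Or.inr hgx.ne)) (Or.inr hJ)
      refine Tendsto.ennrpow_const _ (Tendsto.add ?_ tendsto_const_nhds)
      simp_rw [hcd]
      exact ENNReal.Tendsto.div_const hWx (Or.inr hZ0)
    · rw [lintegral_const_mul _ (hFk k)]
      exact lintegral_avg_mul_cubeDens_le hd hs hU hα hε g hg hgi k
  have hmeas' : Measurable fun x => g x * (W x / Z) ^ (-p) := by simpa using hmeas 0
  rw [← lintegral_const_mul _ hmeas']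
  have hWs : MeasurableSet {x | W x ≠ 0} := (hW (measurableSet_singleton 0)).compl
  refine lintegral_le_of_tendsto_ae (F := fun j x =>
    Jrd s d * (g x * (W x / Z + ENNReal.ofReal (1 / ((j : ℝ) + 1))) ^ (-p)))
    (fun j => (hmeas _).const_mul _) ?_ tendsto_const_nhds
    (.of_forall fun j => (setLIntegral_le_lintegral _ _).trans (main _ (by positivity)))
  filter_upwards [ae_restrict_of_ae hgae, ae_restrict_mem hWs] with x hgx hWx
  refine ENNReal.Tendsto.const_mul (ENNReal.Tendsto.const_mul ?_ (Or.inr hgx.ne)) (Or.inr hJ)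
  refine Tendsto.ennrpow_const _ ?_
  have h0 : Tendsto (fun j : ℕ => ENNReal.ofReal (1 / ((j : ℝ) + 1))) atTop (𝓝 0) := by
    rw [← ENNReal.ofReal_zero]
    exact ENNReal.tendsto_ofReal tendsto_one_div_add_atTop_nhds_zero_nat
  simpa using tendsto_const_nhds (x := W x / Z) |>.add h0

theorem mul_lintegral_fdil_le_qerr_dilate {d : ℕ} {s : ℝ} (hs : 0 < s)
    {f : EuclideanSpace ℝ (Fin d) → ℝ} (hfm : Measurable f)
    {P : Measure (EuclideanSpace ℝ (Fin d))}
    (hP : volume.withDensity (fun x => ENNReal.ofReal (f x)) ≤ P)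
    (γ : Finset (EuclideanSpace ℝ (Fin d))) {θ : ℝ} (hθ : 0 < θ)
    (μ : EuclideanSpace ℝ (Fin d)) :
    ENNReal.ofReal θ ^ (s + d : ℝ) *
      ∫⁻ x, ENNReal.ofReal (fdil f θ μ x) * ENNReal.ofReal (qdist x γ) ^ s ≤
        qerr P s (dilate γ θ μ) := by
  have haff : ∀ x : EuclideanSpace ℝ (Fin d), μ + θ • (x - μ) = (μ - θ • μ) + θ • x := by
    intro x; rw [smul_sub]; abel
  have hθ0 : ENNReal.ofReal θ ≠ 0 := by simpa using hθ
  have hm : ∀ γ : Finset (EuclideanSpace ℝ (Fin d)),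
      Measurable fun x => ENNReal.ofReal (qdist x γ) ^ s := fun γ =>
    (measurable_qdist γ).ennreal_ofReal.pow_const _
  unfold qerr
  refine le_trans ?_ (lintegral_mul_le_of_withDensity_le hfm.ennreal_ofReal (hm _) hP)
  have hfd : Measurable fun x =>
      ENNReal.ofReal (f x) * ENNReal.ofReal (qdist x (dilate γ θ μ)) ^ s :=
    hfm.ennreal_ofReal.mul (hm _)
  rw [lintegral_affine (μ - θ • μ) hθ _ hfd,
    ENNReal.rpow_add _ _ hθ0 (by finiteness), ENNReal.rpow_natCast, mul_comm (_ ^ s), mul_assoc]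
  gcongr
  rw [← lintegral_const_mul']
  · refine lintegral_mono fun x => le_of_eq ?_
    unfold fdil dilate
    simp_rw [haff]
    rw [qdist_affine _ hθ, ENNReal.ofReal_mul hθ.le, ENNReal.mul_rpow_of_nonneg _ _ hs.le]
    ring
  · exact ENNReal.rpow_ne_top_of_nonneg hs.le (by finiteness)

theorem le_liminf_of_forall_ultrafilter {a : ℕ → ℝ≥0∞} {L : ℝ≥0∞}
    (h : ∀ U : Ultrafilter ℕ, (U : Filter ℕ) ≤ atTop → L ≤ ulim U a) : L ≤ liminf a atTop := by
  by_contra! hlt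
  obtain ⟨c, hc1, hc2⟩ := exists_between hlt
  have hfreq : ∃ᶠ n in atTop, a n < c := frequently_lt_of_liminf_lt (by isBoundedDefault) hc1
  have hne : NeBot (atTop ⊓ 𝓟 {n | a n < c}) := frequently_mem_iff_neBot.1 hfreq
  let U := Ultrafilter.of (atTop ⊓ 𝓟 {n | a n < c})
  have hU : (U : Filter ℕ) ≤ atTop ⊓ 𝓟 {n | a n < c} := Ultrafilter.of_le _
  have hUc : ∀ᶠ n in (U : Filter ℕ), a n ≤ c := by
    filter_upwards [(hU.trans inf_le_right) (mem_principal_self _)] with n hn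
    exact le_of_lt hn
  have := (h U (hU.trans inf_le_left)).trans (le_of_tendsto (tendsto_ulim U a) hUc)
  exact absurd hc2 (not_lt.2 this)

/-- **Theorem 2.1, lower estimate.**
Let `r, s > 0`, let `X ~ P` on `ℝ^d` with nonzero a.c. part `f·λ_d` and
`E|X|^{r+η} < ∞` for some `η > 0`.  If `(α_n)` is asymptotically `L^r(P)`-optimal,
then for every `θ > 0` and `μ ∈ ℝ^d`,
`liminf_n n^{s/d} ∫ d(x,α_n^{θ,μ})^s dP ≥ θ^{s+d} J_{s,d} (∫ f^{d/(d+r)})^{s/d}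
  ∫_{f>0} f_{θ,μ} f^{-s/(d+r)} dλ_d`. -/
theorem stmt_0 {d : ℕ} (hd : 1 ≤ d) (r s : ℝ) (hr : 0 < r) (hs : 0 < s)
    (f : EuclideanSpace ℝ (Fin d) → ℝ) (hf0 : ∀ x, 0 ≤ f x) (hfm : Measurable f)
    (P Ps : Measure (EuclideanSpace ℝ (Fin d))) [IsProbabilityMeasure P]
    (hdecomp : P = volume.withDensity (fun x => ENNReal.ofReal (f x)) + Ps)
    (hsing : Ps.MutuallySingular volume)
    (hne : volume.withDensity (fun x => ENNReal.ofReal (f x)) ≠ 0)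
    (η : ℝ) (hη : 0 < η)
    (hmom : (∫⁻ x, ENNReal.ofReal ‖x‖ ^ (r + η) ∂P) ≠ ⊤)
    (α : ℕ → Finset (EuclideanSpace ℝ (Fin d))) (hα : AsympOptimalSeq P f r α)
    (θ : ℝ) (hθ : 0 < θ) (μ : EuclideanSpace ℝ (Fin d)) :
    ENNReal.ofReal θ ^ (s + d : ℝ) * Jrd s d *
        (∫⁻ x, ENNReal.ofReal (f x) ^ ((d : ℝ) / ((d : ℝ) + r))) ^ (s / (d : ℝ)) *
        (∫⁻ x in {x | 0 < f x},
          ENNReal.ofReal (fdil f θ μ x) * ENNReal.ofReal (f x) ^ (-(s / ((d : ℝ) + r)))) ≤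
      liminf (fun n : ℕ => (n : ℝ≥0∞) ^ (s / (d : ℝ)) * qerr P s (dilate (α n) θ μ)) atTop := by
  have hd0 : (0 : ℝ) < d := by exact_mod_cast hd
  have ht : 0 < r / d := by positivity
  have hq : (d : ℝ) / (d + r) = 1 / (1 + r / d) := by field_simp
  have hq' : ((d : ℝ) + r) / d = 1 + r / d := by field_simp
  have hP : volume.withDensity (fun x => ENNReal.ofReal (f x)) ≤ P := by
    rw [hdecomp]; exact Measure.le_add_right le_rfl
  set F : EuclideanSpace ℝ (Fin d) → ℝ≥0∞ := fun x => ENNReal.ofReal (f x) with hFdef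
  have hF : Measurable F := hfm.ennreal_ofReal
  have hFi : ∫⁻ x, F x ≠ ⊤ := by
    have h := lintegral_mul_le_of_withDensity_le hF (measurable_const (a := (1 : ℝ≥0∞))) hP
    simp only [mul_one, lintegral_one, measure_univ] at h
    exact ne_top_of_le_ne_top ENNReal.one_ne_top h
  have hWm : Measurable fun x => F x ^ (1 / (1 + r / d)) := hF.pow_const _
  have hW0 : ∀ x, F x ^ (1 / (1 + r / d)) = 0 ↔ F x = 0 := fun x =>
    ENNReal.rpow_eq_zero_iff_of_pos (by positivity)
  have hZt := lintegral_rpow_ne_top_of_moment hd hr hη hF hP hmom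
  have hZ0 : ∫⁻ x, F x ^ (1 / (1 + r / d)) ≠ 0 := by
    intro h0
    rw [lintegral_eq_zero_iff hWm] at h0
    refine hne (withDensity_eq_zero_iff hF.aemeasurable |>.2 ?_)
    filter_upwards [h0] with x hx using (hW0 x).1 hx
  set g : EuclideanSpace ℝ (Fin d) → ℝ≥0∞ := fun x => ENNReal.ofReal (fdil f θ μ x) with hgdef
  have hg : Measurable g := by
    refine Measurable.ennreal_ofReal (hfm.comp ?_)
    fun_prop
  have hgi : ∫⁻ x, g x ≠ ⊤ := by
    have hθ0 : ENNReal.ofReal θ ^ d ≠ 0 := pow_ne_zero _ (by simpa using hθ)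
    rw [lintegral_affine (μ - θ • μ) hθ F hF] at hFi
    have hgF : ∀ y, g y = F (μ - θ • μ + θ • y) := by
      intro y
      simp only [g, F, fdil]
      congr 2
      rw [smul_sub]
      abel
    simp_rw [hgF]
    exact fun h => hFi (by rw [h, ENNReal.mul_top hθ0])
  set Z := ∫⁻ x, F x ^ (1 / (1 + r / d)) with hZ
  have hQ : Qr f r = Jrd r d * Z ^ (1 + r / d) := by
    unfold Qr
    rw [hq, hq']
  refine le_liminf_of_forall_ultrafilter fun U hU => ?_
  have hopt : locErr U α r F univ ≤ Jrd r d * Z ^ (1 + r / d) := by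
    rw [← hQ, ← ulim_eq_of_tendsto (hα.2.mono_left hU)]
    refine ulim_mono (.of_forall fun n => ?_)
    gcongr
    rw [setLIntegral_univ]
    exact lintegral_mul_le_of_withDensity_le hF
      ((measurable_qdist _).ennreal_ofReal.pow_const _) hP
  have hmain := Jrd_mul_lintegral_le_locErr hd hs hU hα.1 hWm hg hgi hZ0 hZt
    (dens_cube_mul_eq hd hr hU hα.1 F hF hFi hZ0 hZt hopt)
  have hset : {x | F x ^ (1 / (1 + r / d)) ≠ 0} = {x | 0 < f x} := by
    ext x
    simp only [mem_ofPred_eq, ne_eq, hW0, F, ENNReal.ofReal_eq_zero, not_le]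
  have hpos : MeasurableSet {x | 0 < f x} := measurableSet_lt measurable_const hfm
  have hint : ∫⁻ x in {x | F x ^ (1 / (1 + r / d)) ≠ 0},
      g x * (F x ^ (1 / (1 + r / d)) / Z) ^ (-(s / d)) =
      Z ^ (s / d) * ∫⁻ x in {x | 0 < f x}, g x * F x ^ (-(s / (d + r))) := by
    have hgF : Measurable fun x => g x * F x ^ (-(s / (d + r))) := hg.mul (hF.pow_const _)
    rw [hset, ← lintegral_const_mul _ hgF]
    refine setLIntegral_congr_fun hpos fun x hx => ?_
    have hFx : F x ^ (1 / (1 + r / d)) ≠ 0 := by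
      rw [Ne, hW0]
      simpa [F] using hx
    have hexp : 1 / (1 + r / d) * -(s / d) = -(s / (d + r)) := by field_simp
    rw [div_eq_mul_inv, ENNReal.mul_rpow_of_ne_zero hFx (ENNReal.inv_ne_zero.2 hZt),
      ENNReal.inv_rpow, ENNReal.rpow_neg Z, inv_inv, ← ENNReal.rpow_mul, hexp]
    ring
  rw [← hZ, hint] at hmain
  have hθt : ENNReal.ofReal θ ^ (s + d : ℝ) ≠ ⊤ :=
    ENNReal.rpow_ne_top_of_nonneg (by positivity) (by finiteness)
  have hdil : ENNReal.ofReal θ ^ (s + d : ℝ) * locErr U α s g univ ≤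
      ulim U fun n : ℕ => (n : ℝ≥0∞) ^ (s / d) * qerr P s (dilate (α n) θ μ) := by
    refine le_of_tendsto_of_tendsto (ENNReal.Tendsto.const_mul (tendsto_ulim U _) (Or.inr hθt))
      (tendsto_ulim U _) (.of_forall fun n => ?_)
    simp only [setLIntegral_univ]
    rw [mul_left_comm]
    gcongr
    exact mul_lintegral_fdil_le_qerr_dilate hs hfm hP (α n) hθ μ
  refine le_trans ?_ hdil
  rw [hq, mul_assoc, mul_assoc]
  gcongr
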